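/- arXiv:math-ph/0505067 — 2 statements merged into one kernel-verified Lean document; each statement's English description precedes it below -/
import Mathlib

section
/- Let N_ε^± ⊆ M be two smooth families of compact submanifolds of a smooth manifold M with the same limit N_0 := N_0^+ = N_0^-. If m ∈ N_0 is a transverse infinitesimal intersection, then in a neighbourhood of m there is a smooth family of submanifolds Λ_ε such that Λ_0 ⊆ N_0 and Λ_ε equals the intersection N_ε^+ ∩ N_ε^- (near m) for all small enough ε ≠ 0. -/
open Filter Set Metric MeasureTheory
open scoped Topology

noncomputable section

/-- The tangent space of a subset `S` of a normed space at a point `x`, defined as the linear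
span of the tangent cone of `S` at `x`. -/
def Tang {E : Type*} [NormedAddCommGroup E] [NormedSpace ℝ E] (S : Set E) (x : E) :
    Submodule ℝ E :=
  Submodule.span ℝ (tangentConeAt ℝ S x)

/-- `S` is a smooth `d`-dimensional submanifold of the normed space `E`: around each of its
points, `S` can be straightened, by a smooth diffeomorphism of the ambient space, to a
`d`-dimensional linear subspace. -/
def IsSubmanifold {E : Type*} [NormedAddCommGroup E] [NormedSpace ℝ E] (d : ℕ) (S : Set E) :
    Prop :=
  ∀ x ∈ S, ∃ (U : Set E) (φ : PartialHomeomorph E E) (V : Submodule ℝ E),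
    x ∈ U ∧ IsOpen U ∧ U ⊆ φ.source ∧
    ContDiffOn ℝ (⊤ : ℕ∞) φ φ.source ∧ ContDiffOn ℝ (⊤ : ℕ∞) φ.symm φ.target ∧
    Module.finrank ℝ V = d ∧ φ '' (S ∩ U) = φ '' U ∩ (V : Set E)

/-- A smooth family of `d`-dimensional submanifolds `N ε ⊆ E` (`ε ∈ ℝ`): the union
`⋃ ε, N ε × {ε}` is a smooth submanifold of `E × ℝ`. -/
def IsSmoothFamilySub {E : Type*} [NormedAddCommGroup E] [NormedSpace ℝ E] (d : ℕ)
    (N : ℝ → Set E) : Prop :=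
  IsSubmanifold (d + 1) {p : E × ℝ | p.1 ∈ N p.2}

/-- A smooth family of compact `d`-dimensional submanifolds. -/
def IsSmoothFamily {E : Type*} [NormedAddCommGroup E] [NormedSpace ℝ E] (d : ℕ)
    (N : ℝ → Set E) : Prop :=
  (∀ ε, IsCompact (N ε)) ∧ IsSmoothFamilySub d N

/-- `φ` is the flow of the time-dependent vector field `X`: `φ 0 = id` and
`d/dε (φ ε m) = X ε (φ ε m)`. -/
def IsFlowOf {E : Type*} [NormedAddCommGroup E] [NormedSpace ℝ E]
    (X : ℝ → E → E) (φ : ℝ → E → E) : Prop :=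
  (∀ m, φ 0 m = m) ∧ ∀ ε m, HasDerivAt (fun t => φ t m) (X ε (φ ε m)) ε

/-- The smooth time-dependent vector field `X`, with flow `φ`, generates the family `N`:
`φ ε (N 0) = N ε` for `ε` near `0`, and `X 0` is not tangent to `N 0` except where it
vanishes. -/
def GeneratesWith {E : Type*} [NormedAddCommGroup E] [NormedSpace ℝ E]
    (N : ℝ → Set E) (X : ℝ → E → E) (φ : ℝ → E → E) : Prop :=
  ContDiff ℝ (⊤ : ℕ∞) (fun p : ℝ × E => X p.1 p.2) ∧ IsFlowOf X φ ∧
  (∀ᶠ ε in 𝓝 (0 : ℝ), φ ε '' N 0 = N ε) ∧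
  ∀ m ∈ N 0, X 0 m ∈ Tang (N 0) m → X 0 m = 0

/-- The time-dependent vector field `X` generates the family `N`. -/
def Generates {E : Type*} [NormedAddCommGroup E] [NormedSpace ℝ E]
    (N : ℝ → Set E) (X : ℝ → E → E) : Prop :=
  ∃ φ, GeneratesWith N X φ

/-- `Xp, Xm` are generating vector fields for the two families `Np, Nm` (deformations of the
same `N 0 = Np 0 = Nm 0`), normalised so that `X₀⁺ - X₀⁻` is not tangent to `N 0` except
where it vanishes. -/
def GeneratesPair {E : Type*} [NormedAddCommGroup E] [NormedSpace ℝ E]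
    (Np Nm : ℝ → Set E) (Xp Xm : ℝ → E → E) : Prop :=
  Generates Np Xp ∧ Generates Nm Xm ∧
  ∀ m ∈ Np 0, (Xp 0 m - Xm 0 m) ∈ Tang (Np 0) m → Xp 0 m = Xm 0 m

/-- The Lie bracket of two vector fields on a normed space. -/
def lieBracketVF {E : Type*} [NormedAddCommGroup E] [NormedSpace ℝ E]
    (X Y : E → E) (m : E) : E :=
  fderiv ℝ Y m (X m) - fderiv ℝ X m (Y m)

/-- The operator `D_{m,X₀^±} : Y ↦ [Ỹ, X₀⁺ - X₀⁻]_m`.  At an infinitesimal intersection `m`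
(where `X₀⁺ - X₀⁻` vanishes) the Lie bracket `[Ỹ, X₀⁺ - X₀⁻]_m` is independent of the chosen
extension `Ỹ` of `Y`, and equals the derivative of `X₀⁺ - X₀⁻` at `m` in the direction `Y`. -/
def Dop {E : Type*} [NormedAddCommGroup E] [NormedSpace ℝ E]
    (Xp Xm : ℝ → E → E) (m : E) : E →ₗ[ℝ] E :=
  (fderiv ℝ (fun x => Xp 0 x - Xm 0 x) m).toLinearMap

section Hadamard

variable {E F : Type*} [NormedAddCommGroup E] [NormedSpace ℝ E] [FiniteDimensional ℝ E]
  [NormedAddCommGroup F] [NormedSpace ℝ F]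

theorem hasFDerivAt_intervalIntegral_of_contDiff {f : E × ℝ → F} (hf : ContDiff ℝ 1 f) (x : E) :
    HasFDerivAt (fun x => ∫ s in (0 : ℝ)..1, f (x, s))
      (∫ s in (0 : ℝ)..1, (fderiv ℝ f (x, s)).comp (ContinuousLinearMap.inl ℝ E ℝ)) x := by
  have hcont : Continuous fun p : E × ℝ =>
      (fderiv ℝ f p).comp (ContinuousLinearMap.inl ℝ E ℝ) :=
    (hf.continuous_fderiv one_ne_zero).clm_comp continuous_const
  obtain ⟨C, hC⟩ := ((isCompact_closedBall x 1).prod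
    (isCompact_Icc (a := (0 : ℝ)) (b := 1))).exists_bound_of_continuousOn hcont.continuousOn
  refine intervalIntegral.hasFDerivAt_integral_of_dominated_of_fderiv_le
    (F := fun x s => f (x, s))
    (F' := fun x s => (fderiv ℝ f (x, s)).comp (ContinuousLinearMap.inl ℝ E ℝ))
    (bound := fun _ => C) (closedBall_mem_nhds x one_pos) (Eventually.of_forall fun y => ?_)
    ?_ ?_ (ae_of_all _ fun s hs y hy => ?_) intervalIntegrable_const
    (ae_of_all _ fun s _ y _ => ?_)
  · exact (hf.continuous.comp (Continuous.prodMk_right y)).aestronglyMeasurable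
  · exact (hf.continuous.comp (Continuous.prodMk_right x)).intervalIntegrable _ _
  · exact (hcont.comp (Continuous.prodMk_right x)).aestronglyMeasurable
  · rw [uIoc_of_le zero_le_one] at hs
    exact hC (y, s) ⟨hy, Ioc_subset_Icc_self hs⟩
  · exact ((hf.differentiable one_ne_zero (y, s)).hasFDerivAt).comp y (hasFDerivAt_prodMk_left y s)

theorem contDiff_intervalIntegral {f : E × ℝ → F} (hf : ContDiff ℝ (⊤ : ℕ∞) f) :
    ContDiff ℝ (⊤ : ℕ∞) fun x => ∫ s in (0 : ℝ)..1, f (x, s) := by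
  refine contDiff_infty.2 fun n => ?_
  induction n generalizing f with
  | zero =>
    exact contDiff_zero.2 <| intervalIntegral.continuous_parametric_intervalIntegral_of_continuous'
      (f := fun x s => f (x, s)) hf.continuous 0 1
  | succ n ih =>
    have hf1 : ContDiff ℝ 1 f := hf.of_le (by exact_mod_cast le_top)
    have hder := hasFDerivAt_intervalIntegral_of_contDiff hf1
    rw [Nat.cast_add, Nat.cast_one, contDiff_succ_iff_fderiv_apply]
    refine ⟨fun x => (hder x).differentiableAt, fun h => absurd h (by simp), fun y => ?_⟩
    have hfy : ContDiff ℝ (⊤ : ℕ∞) fun p : E × ℝ => fderiv ℝ f p (y, 0) :=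
      (hf.fderiv_right (m := (⊤ : ℕ∞)) (by simp)).clm_apply contDiff_const
    convert ih hfy using 2 with x
    have hcont : Continuous fun s : ℝ =>
        (fderiv ℝ f (x, s)).comp (ContinuousLinearMap.inl ℝ E ℝ) :=
      ((hf1.continuous_fderiv one_ne_zero).comp (Continuous.prodMk_right x)).clm_comp
        continuous_const
    rw [(hder x).fderiv,
      ContinuousLinearMap.intervalIntegral_apply (hcont.intervalIntegrable _ _) y]
    simp

/-- Hadamard's lemma: the increment of a smooth function along the projection
`z ↦ z - τ z • v` is divisible by `τ`. -/
theorem exists_contDiff_sub_eq_smul [CompleteSpace F] {H : E → F} (hH : ContDiff ℝ (⊤ : ℕ∞) H)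
    (τ : E →L[ℝ] ℝ) (v : E) :
    ∃ k : E → F, ContDiff ℝ (⊤ : ℕ∞) k ∧ (∀ z, H z - H (z - τ z • v) = τ z • k z) ∧
      ∀ z, τ z = 0 → k z = fderiv ℝ H z v := by
  have hd : ContDiff ℝ (⊤ : ℕ∞) fun p : E × ℝ => fderiv ℝ H (p.1 - (p.2 * τ p.1) • v) v := by
    refine ContDiff.clm_apply ?_ contDiff_const
    exact (hH.fderiv_right (m := (⊤ : ℕ∞)) (by simp)).comp (by fun_prop)
  refine ⟨_, contDiff_intervalIntegral hd, fun z => ?_, fun z hz => by simp [hz]⟩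
  have hderiv : ∀ s ∈ uIcc (0 : ℝ) 1, HasDerivAt (fun s => -H (z - (s * τ z) • v))
      (τ z • fderiv ℝ H (z - (s * τ z) • v) v) s := by
    intro s _
    have h1 : HasDerivAt (fun s : ℝ => z - (s * τ z) • v) (-(τ z • v)) s := by
      simpa using (((hasDerivAt_id s).mul_const (τ z)).smul_const v).const_sub z
    have h2 := ((hH.differentiable (by simp) (z - (s * τ z) • v)).hasFDerivAt.comp_hasDerivAt
      s h1).neg
    exact h2.congr_deriv (by simp)
  have hc : Continuous fun s : ℝ => τ z • fderiv ℝ H (z - (s * τ z) • v) v :=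
    (hd.continuous.comp (Continuous.prodMk_right z)).const_smul (τ z)
  have := intervalIntegral.integral_eq_sub_of_hasDerivAt hderiv (hc.intervalIntegrable _ _)
  rw [intervalIntegral.integral_smul] at this
  rw [this]
  simp
  abel

theorem exists_contDiff_eventuallyEq {f : E → F} {U : Set E} {x : E}
    (hf : ContDiffOn ℝ (⊤ : ℕ∞) f U) (hU : U ∈ 𝓝 x) :
    ∃ g : E → F, ContDiff ℝ (⊤ : ℕ∞) g ∧ g =ᶠ[𝓝 x] f := by
  obtain ⟨r, hr, hrU⟩ := Metric.mem_nhds_iff.1 hU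
  let χ : ContDiffBump x := ⟨r / 4, r / 2, by positivity, by linarith⟩
  refine ⟨fun z => χ z • f z, contDiff_iff_contDiffAt.2 fun z => ?_, ?_⟩
  · by_cases hz : z ∈ ball x r
    · exact χ.contDiff.contDiffAt.smul
        (hf.contDiffAt (mem_of_superset (isOpen_ball.mem_nhds hz) hrU))
    · have hz' : z ∉ tsupport χ := by
        rw [χ.tsupport_eq]
        intro h
        exact hz (closedBall_subset_ball (half_lt_self hr) h)
      refine (contDiffAt_const (c := (0 : F))).congr_of_eventuallyEq ?_
      filter_upwards [notMem_tsupport_iff_eventuallyEq.1 hz'] with y hy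
      simp [hy]
  · filter_upwards [χ.eventuallyEq_one] with y hy
    simp [hy]

end Hadamard

section Submersion

variable {E F : Type*} [NormedAddCommGroup E] [NormedSpace ℝ E] [FiniteDimensional ℝ E]
  [NormedAddCommGroup F] [NormedSpace ℝ F] [FiniteDimensional ℝ F]

/-- A submersion is linearised, near any given point, by a change of coordinates of its domain
which is tangent to the identity there. -/
theorem exists_chart_of_surjective_fderiv {f : E → F} {U : Set E} {x₀ : E} (hU : IsOpen U)
    (hf : ContDiffOn ℝ (⊤ : ℕ∞) f U) (hx₀ : x₀ ∈ U)
    (hsurj : Function.Surjective (fderiv ℝ f x₀)) :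
    ∃ φ : OpenPartialHomeomorph E E, x₀ ∈ φ.source ∧ φ.source ⊆ U ∧
      ContDiffOn ℝ (⊤ : ℕ∞) φ φ.source ∧ ContDiffOn ℝ (⊤ : ℕ∞) φ.symm φ.target ∧
      (∀ x ∈ φ.source, fderiv ℝ f x₀ (φ x) = f x) ∧
      HasFDerivAt φ.symm (ContinuousLinearMap.id ℝ E) (φ x₀) ∧
      ∀ x ∈ φ.source, Function.Surjective (fderiv ℝ f x) := by
  set L := fderiv ℝ f x₀ with hL
  obtain ⟨R₀, hR₀⟩ :=
    L.toLinearMap.exists_rightInverse_of_surjective (LinearMap.range_eq_top.2 hsurj)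
  let R : F →L[ℝ] E := LinearMap.toContinuousLinearMap R₀
  have hR : ∀ y, L (R y) = y := fun y => DFunLike.congr_fun hR₀ y
  have hdf : ∀ x ∈ U, HasFDerivAt f (fderiv ℝ f x) x := fun x hx =>
    ((hf.contDiffAt (hU.mem_nhds hx)).differentiableAt (by simp)).hasFDerivAt
  let ψ : E → E := fun x => x + R (f x - L x)
  have hψ : ContDiffOn ℝ (⊤ : ℕ∞) ψ U :=
    contDiffOn_id.add (R.contDiff.comp_contDiffOn (hf.sub L.contDiff.contDiffOn))
  have hdψ : ∀ x ∈ U, HasFDerivAt ψ (ContinuousLinearMap.id ℝ E +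
      R.comp (fderiv ℝ f x - L)) x := fun x hx =>
    (hasFDerivAt_id x).add (R.hasFDerivAt.comp x ((hdf x hx).sub L.hasFDerivAt))
  have hψ₀ : HasFDerivAt ψ ((ContinuousLinearEquiv.refl ℝ E : E ≃L[ℝ] E) : E →L[ℝ] E) x₀ := by
    simpa [← hL] using hdψ x₀ hx₀
  have hψat : ContDiffAt ℝ (⊤ : ℕ∞) ψ x₀ := hψ.contDiffAt (hU.mem_nhds hx₀)
  let Φ := hψat.toOpenPartialHomeomorph ψ hψ₀ (by simp)
  have hΦψ : ∀ x, Φ x = ψ x := fun x => rfl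
  have hev : ∀ᶠ x in 𝓝 x₀, x ∈ U ∧
      fderiv ℝ ψ x ∈ range (ContinuousLinearEquiv.toContinuousLinearMap :
        (E ≃L[ℝ] E) → E →L[ℝ] E) := by
    refine (hU.eventually_mem hx₀).and ?_
    have hc : ContinuousAt (fderiv ℝ ψ) x₀ :=
      (hψat.fderiv_right (m := (⊤ : ℕ∞)) (by simp)).continuousAt
    apply hc.eventually_mem
    rw [hψ₀.fderiv]
    exact ContinuousLinearEquiv.nhds _
  obtain ⟨O, hOsub, hO, hx₀O⟩ := _root_.mem_nhds_iff.1 hev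
  let φ := Φ.restrOpen O hO
  have hsrc : φ.source = Φ.source ∩ O := Φ.restrOpen_source O hO
  have hφΦ : ∀ x, φ x = ψ x := fun x => rfl
  have hx₀φ : x₀ ∈ φ.source := by
    rw [hsrc]
    exact ⟨hψat.mem_toOpenPartialHomeomorph_source hψ₀ (by simp), hx₀O⟩
  have hφU : φ.source ⊆ U := fun x hx => (hOsub (hsrc ▸ hx).2).1
  have hLφ : ∀ x, L (φ x) = f x := fun x => by simp [hφΦ, ψ, hR]
  refine ⟨φ, hx₀φ, hφU, hψ.mono hφU, fun y hy => ?_, fun x _ => hLφ x, ?_, fun x hx y => ?_⟩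
  · have hys := φ.map_target hy
    obtain ⟨e, he⟩ := (hOsub (hsrc ▸ hys).2).2
    refine (φ.contDiffAt_symm hy (f₀' := e) ?_ ?_).contDiffWithinAt
    · rw [he]
      exact (hdψ _ (hφU hys)).differentiableAt.hasFDerivAt
    · exact hψ.contDiffAt (hU.mem_nhds (hφU hys))
  · refine φ.hasFDerivAt_symm (f' := ContinuousLinearEquiv.refl ℝ E) (φ.map_source hx₀φ) ?_
    rw [φ.left_inv hx₀φ]
    exact hψ₀
  · obtain ⟨e, he⟩ := (hOsub (hsrc ▸ hx).2).2
    have h1 : L.comp (fderiv ℝ ψ x) = fderiv ℝ f x := by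
      have h2 := L.hasFDerivAt.comp x (hdψ x (hφU hx)).differentiableAt.hasFDerivAt
      have h3 : (L ∘ ψ) = f := funext hLφ
      rw [h3] at h2
      exact h2.unique (hdf x (hφU hx))
    refine ⟨e.symm (R y), ?_⟩
    rw [← h1, ← he]
    simp [hR]

theorem exists_curve_of_mem_ker_fderiv {f : E → F} {U : Set E} {x₀ y : E} (hU : IsOpen U)
    (hf : ContDiffOn ℝ (⊤ : ℕ∞) f U) (hx₀ : x₀ ∈ U)
    (hsurj : Function.Surjective (fderiv ℝ f x₀)) (hy : fderiv ℝ f x₀ y = 0) :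
    ∃ c : ℝ → E, c 0 = x₀ ∧ HasDerivAt c y 0 ∧ ∀ᶠ s in 𝓝 0, f (c s) = f x₀ := by
  obtain ⟨φ, hφx₀, -, -, -, hφf, hφ', -⟩ := exists_chart_of_surjective_fderiv hU hf hx₀ hsurj
  have hline : HasDerivAt (fun s : ℝ => φ x₀ + s • y) y 0 := by
    simpa using ((hasDerivAt_id (0 : ℝ)).smul_const y).const_add (φ x₀)
  have hline0 : φ x₀ + (0 : ℝ) • y = φ x₀ := by simp
  refine ⟨fun s => φ.symm (φ x₀ + s • y), by simp [φ.left_inv hφx₀], ?_, ?_⟩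
  · rw [← hline0] at hφ'
    exact hφ'.comp_hasDerivAt 0 hline
  · have hev : ∀ᶠ s in 𝓝 (0 : ℝ), φ x₀ + s • y ∈ φ.target := by
      refine hline.continuousAt.eventually_mem (φ.open_target.mem_nhds ?_)
      rw [hline0]
      exact φ.map_source hφx₀
    filter_upwards [hev] with s hs
    rw [← hφf _ (φ.map_target hs), φ.right_inv hs, map_add, map_smul, hy, hφf _ hφx₀]
    simp

theorem isSubmanifold_zeroSet {f : E → F} {U : Set E} {x₀ : E} (hU : IsOpen U)
    (hf : ContDiffOn ℝ (⊤ : ℕ∞) f U) (hx₀ : x₀ ∈ U)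
    (hsurj : Function.Surjective (fderiv ℝ f x₀)) :
    ∃ O ∈ 𝓝 x₀, ∀ O' ⊆ O, IsOpen O' →
      IsSubmanifold (Module.finrank ℝ (fderiv ℝ f x₀).ker) {x | x ∈ O' ∧ f x = 0} := by
  obtain ⟨φ, hφx₀, -, hφ, hφsymm, hφf, -, -⟩ := exists_chart_of_surjective_fderiv hU hf hx₀ hsurj
  refine ⟨φ.source, φ.open_source.mem_nhds hφx₀, fun O' hO' hO'o x hx => ?_⟩
  refine ⟨O', φ.toPartialHomeomorph, (fderiv ℝ f x₀).ker, hx.1, hO'o, hO', hφ, hφsymm, rfl, ?_⟩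
  ext z
  constructor
  · rintro ⟨y, ⟨⟨-, hy⟩, hyO⟩, rfl⟩
    exact ⟨mem_image_of_mem _ hyO, (hφf y (hO' hyO)).trans hy⟩
  · rintro ⟨⟨y, hyO, rfl⟩, hy⟩
    exact ⟨y, ⟨⟨hyO, (hφf y (hO' hyO)).symm.trans hy⟩, hyO⟩, rfl⟩

end Submersion

section Submanifold

variable {E : Type*} [NormedAddCommGroup E] [NormedSpace ℝ E] [FiniteDimensional ℝ E]

theorem IsSubmanifold.exists_defining_function {d : ℕ} {S : Set E} (hS : IsSubmanifold d S)
    {x : E} (hx : x ∈ S) :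
    ∃ (W : Submodule ℝ E) (f : E → W) (U : Set E), IsOpen U ∧ x ∈ U ∧
      ContDiffOn ℝ (⊤ : ℕ∞) f U ∧ Function.Surjective (fderiv ℝ f x) ∧
      ∀ y ∈ U, f y = 0 ↔ y ∈ S := by
  obtain ⟨U, φ, V, hxU, hU, hUφ, hφ, hφsymm, -, hSV⟩ := hS x hx
  obtain ⟨W, hVW⟩ := V.exists_isCompl
  let P₀ := W.projectionOnto V hVW.symm
  let P : E →L[ℝ] W := LinearMap.toContinuousLinearMap P₀
  have hP : ∀ y, P y = 0 ↔ y ∈ V := fun y => by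
    rw [← Submodule.ker_projectionOnto hVW.symm]
    rfl
  have hφU : ContDiffOn ℝ (⊤ : ℕ∞) φ U := hφ.mono hUφ
  have hdφ : HasFDerivAt φ (fderiv ℝ φ x) x :=
    ((hφU.contDiffAt (hU.mem_nhds hxU)).differentiableAt (by simp)).hasFDerivAt
  have hdφsymm := ((hφsymm.differentiableOn (by simp)) (φ x)
    (φ.map_source' (hUφ hxU))).hasFDerivWithinAt
  have hinv : (fderivWithin ℝ φ.symm φ.target (φ x)).comp (fderiv ℝ φ x) =
      ContinuousLinearMap.id ℝ E := by
    have h1 := hdφsymm.comp x (hdφ.hasFDerivWithinAt (s := U))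
      (fun y hy => φ.map_source' (hUφ hy))
    refine ((h1.hasFDerivAt (hU.mem_nhds hxU)).congr_of_eventuallyEq ?_).unique (hasFDerivAt_id x)
    filter_upwards [hU.mem_nhds hxU] with y hy
    exact (φ.left_inv' (hUφ hy)).symm
  have hinj : Function.Injective (fderiv ℝ φ x).toLinearMap :=
    Function.LeftInverse.injective (g := fderivWithin ℝ φ.symm φ.target (φ x))
      fun y => DFunLike.congr_fun hinv y
  refine ⟨W, fun y => P (φ y), U, hU, hxU, P.contDiff.comp_contDiffOn hφU, ?_, fun y hy => ?_⟩
  · have hdf : fderiv ℝ (fun y => P (φ y)) x = P.comp (fderiv ℝ φ x) :=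
      (P.hasFDerivAt.comp x hdφ).fderiv
    rw [hdf]
    exact (LinearMap.range_eq_top.1 (Submodule.range_projectionOnto hVW.symm)).comp
      (LinearMap.injective_iff_surjective.1 hinj)
  · rw [hP]
    constructor
    · intro hyV
      obtain ⟨z, ⟨hzS, hzU⟩, hz⟩ := hSV.ge ⟨mem_image_of_mem φ hy, hyV⟩
      rwa [← φ.toPartialEquiv.injOn (hUφ hzU) (hUφ hy) hz]
    · intro hyS
      exact (hSV.le (mem_image_of_mem φ ⟨hyS, hy⟩)).2

end Submanifold

section Tangency

variable {E F : Type*} [NormedAddCommGroup E] [NormedSpace ℝ E] [NormedAddCommGroup F]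
  [NormedSpace ℝ F]

theorem tang_le_ker {S : Set E} {x : E} {f : E → F} {f' : E →L[ℝ] F} (hf : HasFDerivAt f f' x)
    (hx : x ∈ S) (h0 : ∀ᶠ y in 𝓝 x, y ∈ S → f y = 0) : Tang S x ≤ f'.ker := by
  refine Submodule.span_le.2 fun v hv => ?_
  have hzero : HasFDerivWithinAt f (0 : E →L[ℝ] F) S x := by
    refine (hasFDerivWithinAt_const (0 : F) x S).congr_of_eventuallyEq ?_ (h0.self_of_nhds hx)
    exact eventually_nhdsWithin_iff.2 h0
  exact hf.hasFDerivWithinAt.unique_on hzero hv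

theorem Generates.fderiv_apply_eq_zero {N : ℝ → Set E} {X : ℝ → E → E} (h : Generates N X)
    {x : E} (hx : x ∈ N 0) {f : E × ℝ → F} (hf : DifferentiableAt ℝ f (x, 0))
    (hfN : ∀ᶠ p in 𝓝 (x, (0 : ℝ)), p.1 ∈ N p.2 → f p = 0) :
    fderiv ℝ f (x, 0) (X 0 x, 1) = 0 := by
  obtain ⟨φ, -, ⟨hφ0, hφ⟩, hφN, -⟩ := h
  have hc : HasDerivAt (fun t => (φ t x, t)) (X 0 x, (1 : ℝ)) 0 := by
    have := (hφ 0 x).prodMk (hasDerivAt_id (0 : ℝ))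
    rwa [hφ0] at this
  have hc0 : (φ 0 x, (0 : ℝ)) = (x, 0) := by rw [hφ0]
  have hfc : HasDerivAt (fun t => f (φ t x, t)) (fderiv ℝ f (x, 0) (X 0 x, 1)) 0 := by
    exact hf.hasFDerivAt.comp_hasDerivAt_of_eq 0 hc hc0.symm
  refine hfc.unique ((hasDerivAt_const (0 : ℝ) (0 : F)).congr_of_eventuallyEq ?_)
  rw [← hc0] at hfN
  filter_upwards [hc.continuousAt.eventually hfN, hφN] with t ht htN
  exact ht (htN ▸ mem_image_of_mem _ hx)

theorem fderiv_prodMk_clm {f : E → F} {x : E} (hf : DifferentiableAt ℝ f x) (τ : E →L[ℝ] ℝ) :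
    fderiv ℝ (fun y => (f y, τ y)) x = (fderiv ℝ f x).prod τ :=
  (hf.hasFDerivAt.prodMk τ.hasFDerivAt).fderiv

theorem surjective_prod_clm {L : E →L[ℝ] F} {τ : E →L[ℝ] ℝ} {a : E} (hL : Function.Surjective L)
    (ha : L a = 0) (hτ : τ a = 1) : Function.Surjective (L.prod τ) := by
  rintro ⟨q, r⟩
  obtain ⟨e, rfl⟩ := hL q
  exact ⟨e + (r - τ e) • a, by simp [ha, hτ]⟩

end Tangency

section Division

variable {E F G : Type*} [NormedAddCommGroup E] [NormedSpace ℝ E] [FiniteDimensional ℝ E]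
  [NormedAddCommGroup F] [NormedSpace ℝ F] [FiniteDimensional ℝ F]
  [NormedAddCommGroup G] [NormedSpace ℝ G] [FiniteDimensional ℝ G]

/-- If `g` vanishes on `{τ = 0} ∩ {f = 0}`, then on `{f = 0}` it is divisible by `τ`, and the
quotient restricts on `{τ = 0} ∩ {f = 0}` to the derivative of `g` along any direction `a` which is
tangent to `{f = 0}` and satisfies `τ a = 1`. -/
theorem exists_smul_eq_on_zeroSet {f : E → F} {g : E → G} {τ : E →L[ℝ] ℝ} {U : Set E} {p₀ a₀ : E}
    (hU : IsOpen U) (hf : ContDiffOn ℝ (⊤ : ℕ∞) f U) (hg : ContDiffOn ℝ (⊤ : ℕ∞) g U)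
    (hp₀ : p₀ ∈ U) (hτp₀ : τ p₀ = 0)
    (hsurj : Function.Surjective (fderiv ℝ f p₀)) (ha₀ : fderiv ℝ f p₀ a₀ = 0) (hτa₀ : τ a₀ = 1)
    (hfg : ∀ p ∈ U, τ p = 0 → f p = 0 → g p = 0) :
    ∃ (V : Set E) (K : E → G), IsOpen V ∧ p₀ ∈ V ∧ V ⊆ U ∧ ContDiffOn ℝ (⊤ : ℕ∞) K V ∧
      (∀ p ∈ V, f p = 0 → g p = τ p • K p) ∧
      ∀ p ∈ V, τ p = 0 → f p = 0 → ∀ a, fderiv ℝ f p a = 0 → τ a = 1 → K p = fderiv ℝ g p a := by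
  have hdf : ∀ p ∈ U, DifferentiableAt ℝ f p := fun p hp =>
    (hf.contDiffAt (hU.mem_nhds hp)).differentiableAt (by simp)
  have hdg : ∀ p ∈ U, DifferentiableAt ℝ g p := fun p hp =>
    (hg.contDiffAt (hU.mem_nhds hp)).differentiableAt (by simp)
  have hfτ : ContDiffOn ℝ (⊤ : ℕ∞) (fun p => (f p, τ p)) U := hf.prodMk τ.contDiff.contDiffOn
  have hsurj' : Function.Surjective (fderiv ℝ (fun p => (f p, τ p)) p₀) := by
    rw [fderiv_prodMk_clm (hdf p₀ hp₀)]
    exact surjective_prod_clm hsurj ha₀ hτa₀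
  obtain ⟨φ, hp₀φ, hφU, hφ, hφsymm, hLφ, -, hφsurj⟩ :=
    exists_chart_of_surjective_fderiv hU hfτ hp₀ hsurj'
  rw [fderiv_prodMk_clm (hdf p₀ hp₀)] at hLφ
  have hLf : ∀ p ∈ φ.source, fderiv ℝ f p₀ (φ p) = f p := fun p hp => congrArg Prod.fst (hLφ p hp)
  have hLτ : ∀ p ∈ φ.source, τ (φ p) = τ p := fun p hp => congrArg Prod.snd (hLφ p hp)
  obtain ⟨H, hH, hHg⟩ := exists_contDiff_eventuallyEq
    (hg.comp hφsymm fun z hz => hφU (φ.map_target hz)) (φ.open_target.mem_nhds (φ.map_source hp₀φ))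
  obtain ⟨k, hk, hkH, hkH'⟩ := exists_contDiff_sub_eq_smul hH τ a₀
  obtain ⟨O, hOsub, hO, hp₀O⟩ := _root_.mem_nhds_iff.1
    (hHg.and (φ.open_target.eventually_mem (φ.map_source hp₀φ)))
  have hO' : IsOpen {z | z ∈ O ∧ z - τ z • a₀ ∈ O} := hO.inter (hO.preimage (by fun_prop))
  have hVo := φ.isOpen_inter_preimage hO'
  refine ⟨_, fun p => k (φ p), hVo, ⟨hp₀φ, hp₀O, ?_⟩, fun p hp => hφU hp.1,
    hk.comp_contDiffOn (hφ.mono fun p hp => hp.1), ?_, ?_⟩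
  · rw [hLτ p₀ hp₀φ, hτp₀]
    simpa using hp₀O
  · rintro p ⟨hpφ, hpO, hpO'⟩ hfp
    rw [← hLτ p hpφ, ← hkH (φ p)]
    have hz := (hOsub hpO').2
    have hpz := φ.map_target hz
    have h1 := hLf _ hpz
    have h2 := hLτ _ hpz
    rw [φ.right_inv hz, map_sub, map_smul, ha₀, hLf p hpφ, hfp, smul_zero, sub_zero] at h1
    rw [φ.right_inv hz, map_sub, map_smul, hτa₀, smul_eq_mul, mul_one, sub_self] at h2
    have h3 : g (φ.symm (φ p - τ (φ p) • a₀)) = 0 := hfg _ (hφU hpz) h2.symm h1.symm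
    have h4 : H (φ p - τ (φ p) • a₀) = 0 := (hOsub hpO').1.trans h3
    rw [h4, sub_zero, (hOsub hpO).1, Function.comp_apply, φ.left_inv hpφ]
  · rintro p ⟨hpφ, hpO, -⟩ hτp hfp a ha hτa
    have hpU := hφU hpφ
    have hz := φ.map_source hpφ
    change k (φ p) = _
    rw [hkH' _ ((hLτ p hpφ).trans hτp)]
    have hdsymm := ((hφsymm.contDiffAt (φ.open_target.mem_nhds hz)).differentiableAt
      (by simp)).hasFDerivAt
    have hHz : H =ᶠ[𝓝 (φ p)] g ∘ φ.symm := by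
      filter_upwards [hO.mem_nhds hpO] with z hz using (hOsub hz).1
    have hpz : φ.symm (φ p) = p := φ.left_inv hpφ
    have hgz : HasFDerivAt g (fderiv ℝ g p) (φ.symm (φ p)) := by
      rw [hpz]; exact (hdg p hpU).hasFDerivAt
    have hfz : HasFDerivAt (fun p => (f p, τ p)) ((fderiv ℝ f p).prod τ) (φ.symm (φ p)) := by
      rw [hpz]; exact (hdf p hpU).hasFDerivAt.prodMk τ.hasFDerivAt
    rw [hHz.fderiv_eq, (hgz.comp _ hdsymm).fderiv, ContinuousLinearMap.comp_apply]
    set u := fderiv ℝ φ.symm (φ p) a₀ with hu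
    have hLu : ((fderiv ℝ f p).prod τ) u = ((fderiv ℝ f p₀).prod τ) a₀ := by
      have h1 : HasFDerivAt ((fun p => (f p, τ p)) ∘ φ.symm) ((fderiv ℝ f p₀).prod τ) (φ p) := by
        refine ((fderiv ℝ f p₀).prod τ).hasFDerivAt.congr_of_eventuallyEq ?_
        filter_upwards [φ.open_target.mem_nhds hz] with z hz
        have := hLφ _ (φ.map_target hz)
        rw [φ.right_inv hz] at this
        exact this.symm
      exact DFunLike.congr_fun ((hfz.comp _ hdsymm).unique h1) a₀
    have hfu : fderiv ℝ f p u = 0 := (congrArg Prod.fst hLu).trans ha₀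
    have hτu : τ u = 1 := (congrArg Prod.snd hLu).trans hτa₀
    have hker : fderiv ℝ (fun p => (f p, τ p)) p (u - a) = 0 := by
      rw [fderiv_prodMk_clm (hdf p hpU)]
      simp [hfu, ha, hτu, hτa]
    obtain ⟨c, hc0, hc, hcf⟩ := exists_curve_of_mem_ker_fderiv hU hfτ hpU (hφsurj p hpφ) hker
    have hgc : HasDerivAt (fun s => g (c s)) (fderiv ℝ g p (u - a)) 0 :=
      (hdg p hpU).hasFDerivAt.comp_hasDerivAt_of_eq 0 hc hc0.symm
    have hcU : ∀ᶠ s in 𝓝 (0 : ℝ), c s ∈ U :=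
      hc.continuousAt.eventually_mem (hU.mem_nhds (hc0.symm ▸ hpU))
    have hzero : fderiv ℝ g p (u - a) = 0 := by
      refine hgc.unique ((hasDerivAt_const (0 : ℝ) (0 : G)).congr_of_eventuallyEq ?_)
      filter_upwards [hcU, hcf] with s hs hsf
      exact hfg _ hs ((congrArg Prod.snd hsf).trans hτp) ((congrArg Prod.fst hsf).trans hfp)
    rwa [map_sub, sub_eq_zero] at hzero

end Division

/-- If `K p` and `fderiv ℝ g p (w p)` agree on a level set of the submersion `f` through `p₀`, and
`w p₀ = 0`, then differentiating along the level set only sees the derivative of `w`. -/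
theorem fderiv_apply_eq_of_eq_on_zeroSet {E F G : Type*}
    [NormedAddCommGroup E] [NormedSpace ℝ E] [FiniteDimensional ℝ E]
    [NormedAddCommGroup F] [NormedSpace ℝ F] [FiniteDimensional ℝ F]
    [NormedAddCommGroup G] [NormedSpace ℝ G]
    {f : E → F} {g K : E → G} {w : E → E} {U : Set E}
    {p₀ y : E} (hU : IsOpen U) (hf : ContDiffOn ℝ (⊤ : ℕ∞) f U) (hp₀ : p₀ ∈ U)
    (hsurj : Function.Surjective (fderiv ℝ f p₀)) (hy : fderiv ℝ f p₀ y = 0)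
    (hg : DifferentiableAt ℝ (fderiv ℝ g) p₀) (hK : DifferentiableAt ℝ K p₀)
    (hw : DifferentiableAt ℝ w p₀) (hwp₀ : w p₀ = 0)
    (hKw : ∀ᶠ p in 𝓝 p₀, f p = f p₀ → K p = fderiv ℝ g p (w p)) :
    fderiv ℝ K p₀ y = fderiv ℝ g p₀ (fderiv ℝ w p₀ y) := by
  obtain ⟨c, rfl, hc, hcf⟩ := exists_curve_of_mem_ker_fderiv hU hf hp₀ hsurj hy
  have hKc := hK.hasFDerivAt.comp_hasDerivAt 0 hc
  have hgw := (hg.hasFDerivAt.comp_hasDerivAt 0 hc).clm_apply (hw.hasFDerivAt.comp_hasDerivAt 0 hc)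
  simp only [Function.comp_apply, hwp₀, map_zero, zero_add] at hgw
  refine hKc.unique (hgw.congr_of_eventuallyEq ?_)
  filter_upwards [hcf, hc.continuousAt.eventually hKw] with s hs hsK using hsK hs

/-- Theorem 1.9 of the paper.  If `m ∈ N₀` is a transverse infinitesimal
intersection of two smooth families of compact submanifolds `N_ε^±` deforming the same `N₀`,
then near `m` there is a smooth family of submanifolds `Λ_ε` with `Λ₀ ⊆ N₀` and
`Λ_ε = N_ε⁺ ∩ N_ε⁻` (near `m`) for all small enough `ε ≠ 0`. -/
theorem transverse_infinitesimal_intersection_persists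
    {E : Type*} [NormedAddCommGroup E] [NormedSpace ℝ E] [FiniteDimensional ℝ E]
    (d : ℕ) (Np Nm : ℝ → Set E)
    (hNp : IsSmoothFamily d Np) (hNm : IsSmoothFamily d Nm) (h0 : Np 0 = Nm 0)
    (Xp Xm : ℝ → E → E) (hpair : GeneratesPair Np Nm Xp Xm)
    (m : E) (hm : m ∈ Np 0) (hint : Xp 0 m = Xm 0 m)
    (htrans : (Tang (Np 0) m).map (Dop Xp Xm m) ⊔ Tang (Np 0) m = (⊤ : Submodule ℝ E)) :
    ∃ U ∈ 𝓝 m, ∃ (k : ℕ) (Λ : ℝ → Set E),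
      IsSmoothFamilySub k Λ ∧ m ∈ Λ 0 ∧ Λ 0 ⊆ Np 0 ∧
      ∀ᶠ ε in 𝓝[≠] (0 : ℝ), Λ ε = Np ε ∩ Nm ε ∩ U := by
  obtain ⟨hXp, hXm, -⟩ := hpair
  have hmm : m ∈ Nm 0 := h0 ▸ hm
  obtain ⟨F, f, Uf, hUf, hmf, hf, hfsurj, hfN⟩ :=
    IsSubmanifold.exists_defining_function hNp.2 (x := (m, (0 : ℝ))) hm
  obtain ⟨G, g, Ug, hUg, hmg, hg, hgsurj, hgN⟩ :=
    IsSubmanifold.exists_defining_function hNm.2 (x := (m, (0 : ℝ))) hmm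
  have hUo : IsOpen (Uf ∩ Ug) := hUf.inter hUg
  have hdf : ∀ p ∈ Uf, DifferentiableAt ℝ f p := fun p hp =>
    (hf.contDiffAt (hUf.mem_nhds hp)).differentiableAt (by simp)
  have hdg : ∀ p ∈ Ug, DifferentiableAt ℝ g p := fun p hp =>
    (hg.contDiffAt (hUg.mem_nhds hp)).differentiableAt (by simp)
  have hfX : ∀ x ∈ Np 0, (x, (0 : ℝ)) ∈ Uf → fderiv ℝ f (x, 0) (Xp 0 x, 1) = 0 := fun x hx hxU =>
    hXp.fderiv_apply_eq_zero hx (hdf _ hxU)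
      ((hUf.eventually_mem hxU).mono fun p hp => (hfN p hp).2)
  have hgX : ∀ x ∈ Np 0, (x, (0 : ℝ)) ∈ Ug → fderiv ℝ g (x, 0) (Xm 0 x, 1) = 0 := fun x hx hxU =>
    hXm.fderiv_apply_eq_zero (h0 ▸ hx) (hdg _ hxU)
      ((hUg.eventually_mem hxU).mono fun p hp => (hgN p hp).2)
  have hzero : ∀ p : E × ℝ, p ∈ Uf → p.2 = 0 → f p = 0 → p.1 ∈ Np 0 := fun p hp hp2 hfp =>
    hp2 ▸ (hfN p hp).1 hfp
  obtain ⟨V, K, hV, hmV, hVU, hK, hgK, hKX⟩ := exists_smul_eq_on_zeroSet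
    (τ := ContinuousLinearMap.snd ℝ E ℝ) (a₀ := (Xp 0 m, 1)) hUo (hf.mono inter_subset_left)
    (hg.mono inter_subset_right) ⟨hmf, hmg⟩ rfl hfsurj (hfX m hm hmf) rfl
    fun p hp hp2 hfp => (hgN p hp.2).2 <| by
      have hp2 : p.2 = 0 := hp2
      have := hzero p hp.1 hp2 hfp
      rw [h0, ← hp2] at this
      exact this
  have hKW : ∀ p ∈ V, p.2 = 0 → f p = 0 → K p = fderiv ℝ g p (Xp 0 p.1 - Xm 0 p.1, 0) := by
    rintro ⟨x, t⟩ hp hp2 hfp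
    obtain rfl : t = 0 := hp2
    have hx := hzero (x, 0) (hVU hp).1 rfl hfp
    rw [hKX _ hp rfl hfp (Xp 0 x, 1) (hfX x hx (hVU hp).1) rfl,
      ← sub_zero (fderiv ℝ g (x, 0) (Xp 0 x, 1)), ← hgX x hx (hVU hp).2, ← map_sub]
    simp
  have hdK : DifferentiableAt ℝ K (m, 0) :=
    (hK.contDiffAt (hV.mem_nhds hmV)).differentiableAt (by simp)
  have hX : ∀ X, Generates Np X ∨ Generates Nm X → Differentiable ℝ (X 0) := by
    rintro X (⟨-, h, -⟩ | ⟨-, h, -⟩) <;>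
    exact (h.differentiable (by simp)).comp
      ((differentiable_const (0 : ℝ)).prodMk differentiable_id)
  set W : E → E := fun x => Xp 0 x - Xm 0 x with hW
  have hdW : Differentiable ℝ W := (hX Xp (.inl hXp)).sub (hX Xm (.inr hXm))
  have hWm : W m = 0 := sub_eq_zero.2 hint
  have hfτ : ContDiffOn ℝ (⊤ : ℕ∞) (fun p => (f p, ContinuousLinearMap.snd ℝ E ℝ p)) Uf :=
    hf.prodMk contDiff_snd.contDiffOn
  have hfτsurj : Function.Surjective
      (fderiv ℝ (fun p => (f p, ContinuousLinearMap.snd ℝ E ℝ p)) (m, 0)) := by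
    rw [fderiv_prodMk_clm (hdf _ hmf)]
    exact surjective_prod_clm hfsurj (hfX m hm hmf) rfl
  have hKder : ∀ y : E, fderiv ℝ f (m, 0) (y, 0) = 0 →
      fderiv ℝ K (m, 0) (y, 0) = fderiv ℝ g (m, 0) (fderiv ℝ W m y, 0) := by
    intro y hy
    have hw : HasFDerivAt (fun p : E × ℝ => (W p.1, (0 : ℝ)))
        (((fderiv ℝ W m).comp (ContinuousLinearMap.fst ℝ E ℝ)).prod 0) (m, 0) :=
      (HasFDerivAt.comp (g := W) (m, (0 : ℝ)) (hdW m).hasFDerivAt hasFDerivAt_fst).prodMk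
        (hasFDerivAt_const _ _)
    have hg' : DifferentiableAt ℝ (fderiv ℝ g) (m, 0) :=
      ((hg.contDiffAt (hUg.mem_nhds hmg)).fderiv_right (m := (⊤ : ℕ∞))
        (by simp)).differentiableAt (by simp)
    have := fderiv_apply_eq_of_eq_on_zeroSet hUf hfτ hmf hfτsurj (y := (y, 0))
      (by rw [fderiv_prodMk_clm (hdf _ hmf)]; simp [hy]) hg' hdK hw.differentiableAt
      (by simp [hWm]) ?_
    · rw [this, hw.fderiv]
      simp
    · filter_upwards [hV.mem_nhds hmV] with p hp hfp
      exact hKW p hp (congrArg Prod.snd hfp)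
        ((congrArg Prod.fst hfp).trans ((hfN _ hmf).2 hm))
  have hinl : HasFDerivAt (fun x : E => (x, (0 : ℝ))) (ContinuousLinearMap.inl ℝ E ℝ) m :=
    hasFDerivAt_prodMk_left m 0
  have hTf : Tang (Np 0) m ≤
      ((fderiv ℝ f (m, 0)).comp (ContinuousLinearMap.inl ℝ E ℝ)).ker :=
    tang_le_ker (f := fun x => f (x, 0)) ((hdf _ hmf).hasFDerivAt.comp m hinl) hm
      ((hinl.continuousAt.eventually_mem (hUf.mem_nhds hmf)).mono fun x hx => (hfN _ hx).2)
  have hTg : Tang (Np 0) m ≤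
      ((fderiv ℝ g (m, 0)).comp (ContinuousLinearMap.inl ℝ E ℝ)).ker :=
    h0 ▸ tang_le_ker (f := fun x => g (x, 0)) ((hdg _ hmg).hasFDerivAt.comp m hinl) hmm
      ((hinl.continuousAt.eventually_mem (hUg.mem_nhds hmg)).mono fun x hx => (hgN _ hx).2)
  have hKsurj : ∀ r, ∃ y : E, fderiv ℝ f (m, 0) (y, 0) = 0 ∧ fderiv ℝ K (m, 0) (y, 0) = r := by
    intro r
    obtain ⟨⟨e, t⟩, rfl⟩ := hgsurj r
    obtain ⟨_, ⟨y, hy, rfl⟩, z, hz, hyz⟩ := Submodule.mem_sup.1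
      (htrans.ge (Submodule.mem_top (x := e - t • Xm 0 m)))
    refine ⟨y, hTf hy, ?_⟩
    have hz' : fderiv ℝ g (m, 0) (z, 0) = 0 := hTg hz
    have h1 : (e, t) = (fderiv ℝ W m y, (0 : ℝ)) + (z, 0) + t • (Xm 0 m, (1 : ℝ)) := by
      have h2 : fderiv ℝ W m y + z = e - t • Xm 0 m := hyz
      simp [h2]
    rw [hKder y (hTf hy), h1, map_add, map_add, map_smul, hz', hgX m hm hmg]
    simp
  have hFsurj : ∀ q : F × G, ∃ y : E, fderiv ℝ (fun p => (f p, K p)) (m, 0) (y, 0) = q := by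
    rintro ⟨q, r⟩
    rw [((hdf _ hmf).hasFDerivAt.prodMk hdK.hasFDerivAt).fderiv]
    obtain ⟨⟨e, t⟩, rfl⟩ := hfsurj q
    obtain ⟨y, hfy, hKy⟩ := hKsurj (r - fderiv ℝ K (m, 0) (e - t • Xp 0 m, 0))
    refine ⟨(e - t • Xp 0 m) + y, Prod.ext ?_ ?_⟩
    · have h1 : (e - t • Xp 0 m + y, (0 : ℝ)) = (e, t) - t • (Xp 0 m, (1 : ℝ)) + (y, 0) := by simp
      change fderiv ℝ f (m, 0) _ = _
      rw [h1, map_add, map_sub, map_smul, hfX m hm hmf, hfy]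
      simp
    · have h1 : (e - t • Xp 0 m + y, (0 : ℝ)) = (e - t • Xp 0 m, 0) + (y, 0) := by simp
      change fderiv ℝ K (m, 0) _ = _
      rw [h1, map_add, hKy, add_sub_cancel]
  obtain ⟨O, hO, hOsub⟩ := isSubmanifold_zeroSet hV
    ((hf.mono fun p hp => (hVU hp).1).prodMk hK) hmV fun q => (hFsurj q).imp' (·, 0) fun _ h => h
  have hrank : 0 < Module.finrank ℝ (fderiv ℝ (fun p => (f p, K p)) (m, 0)).ker := by
    obtain ⟨y, hy⟩ := hFsurj (fderiv ℝ (fun p => (f p, K p)) (m, 0) (0, 1))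
    refine Module.finrank_pos_iff_exists_ne_zero.2 ⟨⟨(0, 1) - (y, 0), ?_⟩, fun h => ?_⟩
    · exact (map_sub _ _ _).trans (sub_eq_zero.2 hy.symm)
    · simpa using congrArg (fun z => z.1.2) h
  obtain ⟨δ, hδ, hδO⟩ := Metric.mem_nhds_iff.1 (inter_mem hO (hV.mem_nhds hmV))
  rw [← ball_prod_same] at hδO
  refine ⟨ball m δ, ball_mem_nhds m hδ,
    Module.finrank ℝ (fderiv ℝ (fun p => (f p, K p)) (m, 0)).ker - 1,
    fun ε => {x | (x, ε) ∈ ball m δ ×ˢ ball (0 : ℝ) δ ∧ (f (x, ε), K (x, ε)) = 0},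
    ?_, ⟨⟨mem_ball_self hδ, mem_ball_self hδ⟩, ?_⟩, ?_, ?_⟩
  · have := hOsub _ (hδO.trans inter_subset_left) (isOpen_ball.prod isOpen_ball)
    rw [← Nat.sub_add_cancel hrank] at this
    exact this
  · have hf0 : f (m, 0) = 0 := (hfN _ hmf).2 hm
    have hK0 := hKW _ hmV rfl hf0
    change K (m, 0) = fderiv ℝ g (m, 0) (W m, 0) at hK0
    rw [hf0, hK0, hWm, Prod.mk_zero_zero, map_zero, Prod.mk_zero_zero]
  · rintro x ⟨hx, hfx⟩
    exact hzero (x, 0) (hVU (hδO hx).2).1 rfl (congrArg Prod.fst hfx)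
  · filter_upwards [self_mem_nhdsWithin, mem_nhdsWithin_of_mem_nhds (ball_mem_nhds 0 hδ)]
      with ε hε hεδ
    have hε : ε ≠ 0 := hε
    ext x
    have key : x ∈ ball m δ → ((f (x, ε), K (x, ε)) = 0 ↔ x ∈ Np ε ∧ x ∈ Nm ε) := by
      intro hx
      have hxV : (x, ε) ∈ V := (hδO ⟨hx, hεδ⟩).2
      have hxp : f (x, ε) = 0 ↔ x ∈ Np ε := hfN _ (hVU hxV).1
      have hxm : g (x, ε) = 0 ↔ x ∈ Nm ε := hgN _ (hVU hxV).2
      rw [Prod.mk_eq_zero, ← hxp, ← hxm]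
      refine and_congr_right fun hfx => ?_
      have hgx : g (x, ε) = ε • K (x, ε) := hgK _ hxV hfx
      rw [hgx, smul_eq_zero_iff_right hε]
    constructor
    · rintro ⟨⟨hx, -⟩, hfK⟩
      exact ⟨(key hx).1 hfK, hx⟩
    · rintro ⟨hN, hx⟩
      exact ⟨⟨hx, hεδ⟩, (key hx).2 hN⟩

end
end

section
/- Let N_ε^± ⊆ P_ε ⊆ M be two smooth families of compact submanifolds constrained to a smooth family of compact submanifolds P_ε, with N_0 := N_0^+ = N_0^-. If m ∈ N_0 is an infinitesimal intersection which is transverse in the constraint, then in a neighbourhood of m there is a smooth family of submanifolds Λ_ε such that Λ_0 ⊆ N_0 and Λ_ε equals the intersection N_ε^+ ∩ N_ε^- (near m) for all small enough ε ≠ 0. -/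
open Filter Set Metric MeasureTheory
open scoped Topology

noncomputable section

theorem hasFDerivAt_integral_unit_of_contDiff {H F : Type*} [NormedAddCommGroup H]
    [NormedSpace ℝ H] [FiniteDimensional ℝ H] [NormedAddCommGroup F] [NormedSpace ℝ F]
    [CompleteSpace F] {f : H × ℝ → F} (hf : ContDiff ℝ 1 f) (x : H) :
    HasFDerivAt (fun x => ∫ t in (0 : ℝ)..1, f (x, t))
      (∫ t in (0 : ℝ)..1, (fderiv ℝ f (x, t)).comp (ContinuousLinearMap.inl ℝ H ℝ)) x := by
  have hc : Continuous fun p : H × ℝ => (fderiv ℝ f p).comp (ContinuousLinearMap.inl ℝ H ℝ) :=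
    (hf.continuous_fderiv one_ne_zero).clm_comp continuous_const
  obtain ⟨C, hC⟩ := ((isCompact_closedBall x 1).prod
    (isCompact_Icc (a := (0 : ℝ)) (b := 1))).exists_bound_of_continuousOn hc.continuousOn
  refine (intervalIntegral.hasFDerivAt_integral_of_dominated_of_fderiv_le
    (F' := fun x t => (fderiv ℝ f (x, t)).comp (ContinuousLinearMap.inl ℝ H ℝ))
    (bound := fun _ => C) (closedBall_mem_nhds x one_pos) ?_ ?_ ?_ ?_ ?_ ?_)
  · refine Eventually.of_forall fun y => ?_
    exact (hf.continuous.comp (by fun_prop : Continuous fun t : ℝ => (y, t))).aestronglyMeasurable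
  · exact (hf.continuous.comp (by fun_prop : Continuous fun t : ℝ => (x, t))).intervalIntegrable _ _
  · exact (hc.comp (by fun_prop : Continuous fun t : ℝ => (x, t))).aestronglyMeasurable
  · refine Eventually.of_forall fun t ht y hy => hC (y, t) ⟨hy, ?_⟩
    rw [uIoc_of_le zero_le_one] at ht
    exact Ioc_subset_Icc_self ht
  · exact intervalIntegrable_const
  · refine Eventually.of_forall fun t ht y hy => ?_
    exact ((hf.differentiable one_ne_zero).differentiableAt.hasFDerivAt).comp y
      (hasFDerivAt_prodMk_left y t)

theorem contDiff_integral_unit {H F : Type*} [NormedAddCommGroup H]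
    [NormedSpace ℝ H] [FiniteDimensional ℝ H] [NormedAddCommGroup F] [NormedSpace ℝ F]
    [CompleteSpace F] {f : H × ℝ → F} (hf : ContDiff ℝ (⊤ : ℕ∞) f) :
    ContDiff ℝ (⊤ : ℕ∞) (fun x => ∫ t in (0 : ℝ)..1, f (x, t)) := by
  rw [contDiff_infty]
  intro n
  induction n generalizing f with
  | zero =>
    exact contDiff_zero.2 (continuous_iff_continuousAt.2 fun x =>
      (hasFDerivAt_integral_unit_of_contDiff (hf.of_le (by exact_mod_cast le_top)) x).continuousAt)
  | succ n ih =>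
    have hd := fun x => hasFDerivAt_integral_unit_of_contDiff
      (hf.of_le (by exact_mod_cast le_top)) x
    have hf1 : ContDiff ℝ (⊤ : ℕ∞) (fderiv ℝ f) := hf.fderiv_right (by exact_mod_cast le_top)
    have hc : Continuous fun p : H × ℝ => (fderiv ℝ f p).comp (ContinuousLinearMap.inl ℝ H ℝ) :=
      hf1.continuous.clm_comp continuous_const
    refine contDiff_succ_iff_fderiv_apply.2 ⟨fun x => (hd x).differentiableAt,
      fun h => (WithTop.natCast_ne_top n h).elim, fun y => ?_⟩
    have h2 : (fun x => fderiv ℝ (fun x => ∫ t in (0 : ℝ)..1, f (x, t)) x y) =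
        fun x => ∫ t in (0 : ℝ)..1, fderiv ℝ f (x, t) (y, 0) := by
      funext x
      rw [(hd x).fderiv]
      exact ContinuousLinearMap.intervalIntegral_apply
        ((hc.comp (by fun_prop : Continuous fun t : ℝ => (x, t))).intervalIntegrable _ _) y
    rw [h2]
    exact ih (f := fun p => fderiv ℝ f p (y, 0)) (hf1.clm_apply contDiff_const)

/-- Hadamard's lemma: `g (x, ε) - g (x, 0)` is `ε` times a smooth function. -/
theorem exists_contDiff_eq_add_smul {H F : Type*} [NormedAddCommGroup H]
    [NormedSpace ℝ H] [FiniteDimensional ℝ H] [NormedAddCommGroup F] [NormedSpace ℝ F]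
    [CompleteSpace F] {g : H × ℝ → F} (hg : ContDiff ℝ (⊤ : ℕ∞) g) :
    ∃ b : H × ℝ → F, ContDiff ℝ (⊤ : ℕ∞) b ∧ (∀ x ε, g (x, ε) = g (x, 0) + ε • b (x, ε)) ∧
      ∀ x, b (x, 0) = fderiv ℝ g (x, 0) (0, 1) := by
  have hg1 : ContDiff ℝ (⊤ : ℕ∞) (fderiv ℝ g) := hg.fderiv_right (by exact_mod_cast le_top)
  refine ⟨fun p => ∫ t in (0 : ℝ)..1, fderiv ℝ g (p.1, t * p.2) (0, 1), ?_, ?_, ?_⟩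
  · refine contDiff_integral_unit
      (f := fun q : (H × ℝ) × ℝ => fderiv ℝ g (q.1.1, q.2 * q.1.2) (0, 1))
      ((hg1.comp ?_).clm_apply contDiff_const)
    fun_prop
  · intro x ε
    have hd : ∀ t : ℝ, HasDerivAt (fun t : ℝ => g (x, t * ε))
        (ε • fderiv ℝ g (x, t * ε) (0, 1)) t := by
      intro t
      have h1 : HasDerivAt (fun t : ℝ => (x, t * ε)) (0, ε) t := by
        simpa using (hasDerivAt_const t x).prodMk ((hasDerivAt_id t).mul_const ε)
      have h2 := ((hg.differentiable (by simp)).differentiableAt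
        (x := (x, t * ε))).hasFDerivAt.comp_hasDerivAt t h1
      rw [← map_smul, Prod.smul_mk, smul_zero, smul_eq_mul, mul_one]
      exact h2
    have h3 := intervalIntegral.integral_eq_sub_of_hasDerivAt (a := 0) (b := 1) (fun t _ => hd t) ?_
    · rw [intervalIntegral.integral_smul] at h3
      simp only [one_mul, zero_mul] at h3
      simp only [h3]; abel
    · refine Continuous.intervalIntegrable ?_ _ _
      have := (hg1.continuous.comp (by fun_prop : Continuous fun t : ℝ => (x, t * ε)))
      exact continuous_const.smul (this.clm_apply continuous_const)
  · intro x
    simp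

/-- A function which is smooth near `p` agrees near `p` with a globally smooth function. -/
theorem exists_contDiff_eventuallyEq_s6 {H F : Type*} [NormedAddCommGroup H]
    [NormedSpace ℝ H] [FiniteDimensional ℝ H] [NormedAddCommGroup F] [NormedSpace ℝ F]
    {f : H → F} {p : H} (hf : ∀ᶠ z in 𝓝 p, ContDiffAt ℝ (⊤ : ℕ∞) f z) :
    ∃ g : H → F, ContDiff ℝ (⊤ : ℕ∞) g ∧ g =ᶠ[𝓝 p] f := by
  obtain ⟨r, hr, hball⟩ := Metric.nhds_basis_closedBall.mem_iff.1 hf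
  let β : ContDiffBump p := ⟨r / 2, r, by positivity, by linarith⟩
  refine ⟨fun z => β z • f z, contDiff_iff_contDiffAt.2 fun z => ?_, ?_⟩
  · by_cases hz : z ∈ closedBall p r
    · exact β.contDiff.contDiffAt.smul (hball hz)
    · refine (contDiffAt_const (c := (0 : F))).congr_of_eventuallyEq ?_
      filter_upwards [isClosed_closedBall.isOpen_compl.mem_nhds hz] with y hy
      have : β y = 0 := β.zero_of_le_dist (by
        simp only [mem_compl_iff, mem_closedBall, not_le] at hy
        exact hy.le)
      simp [this]
  · filter_upwards [β.eventuallyEq_one] with y hy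
    simp [hy]

/-- The inverse function theorem, producing a smooth local diffeomorphism. -/
theorem exists_openPartialHomeomorph_of_bijective {H H' : Type*} [NormedAddCommGroup H]
    [NormedSpace ℝ H] [FiniteDimensional ℝ H] [NormedAddCommGroup H'] [NormedSpace ℝ H']
    [FiniteDimensional ℝ H'] {f : H → H'} (hf : ContDiff ℝ (⊤ : ℕ∞) f) {p : H}
    (hp : Function.Bijective (fderiv ℝ f p)) :
    ∃ Φ : OpenPartialHomeomorph H H', p ∈ Φ.source ∧ (∀ z, Φ z = f z) ∧
      ContDiffOn ℝ (⊤ : ℕ∞) Φ.symm Φ.target := by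
  have := FiniteDimensional.complete ℝ H
  have := FiniteDimensional.complete ℝ H'
  have hbij : ∀ z, z ∈ fderiv ℝ f ⁻¹' range ((↑) : (H ≃L[ℝ] H') → H →L[ℝ] H') →
      ∃ L : H ≃L[ℝ] H', HasFDerivAt f (L : H →L[ℝ] H') z := by
    rintro z ⟨L, hL⟩
    exact ⟨L, hL ▸ (hf.differentiable (by simp)).differentiableAt.hasFDerivAt⟩
  let A : Set H := fderiv ℝ f ⁻¹' range ((↑) : (H ≃L[ℝ] H') → H →L[ℝ] H')
  have hA : IsOpen A := ContinuousLinearEquiv.isOpen.preimage (hf.continuous_fderiv (by simp))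
  have hpA : p ∈ A := by
    refine ⟨(LinearEquiv.ofBijective (fderiv ℝ f p).toLinearMap hp).toContinuousLinearEquiv, ?_⟩
    ext v
    rfl
  obtain ⟨L, hL⟩ := hbij p hpA
  let Φ := hf.contDiffAt.toOpenPartialHomeomorph f hL (by simp)
  refine ⟨Φ.restrOpen A hA, ⟨hf.contDiffAt.mem_toOpenPartialHomeomorph_source hL _, hpA⟩,
    fun z => rfl, ?_⟩
  intro y hy
  have hys : Φ.symm y ∈ A := by
    have := (Φ.restrOpen A hA).map_target hy
    exact this.2
  have hyt : y ∈ Φ.target := by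
    have h1 := (Φ.restrOpen A hA).map_target hy
    have h2 := (Φ.restrOpen A hA).right_inv hy
    rw [← h2]
    exact Φ.map_source h1.1
  obtain ⟨M, hM⟩ := hbij _ hys
  exact (Φ.contDiffAt_symm hyt hM hf.contDiffAt).contDiffWithinAt

/-- A submanifold is locally the zero set of a smooth submersion to some `ℝᶜ`. -/
theorem IsSubmanifold.exists_defining {H : Type*} [NormedAddCommGroup H]
    [NormedSpace ℝ H] [FiniteDimensional ℝ H] {n : ℕ} {S : Set H} (hS : IsSubmanifold n S) {p : H}
    (hp : p ∈ S) :
    ∃ (c : ℕ) (h : H → (Fin c → ℝ)), ContDiff ℝ (⊤ : ℕ∞) h ∧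
      Function.Surjective (fderiv ℝ h p) ∧ ∀ᶠ z in 𝓝 p, z ∈ S ↔ h z = 0 := by
  obtain ⟨U, φ, V, hpU, hU, hUs, hφ, hψ, -, hSV⟩ := hS p hp
  let ℓ : H →ₗ[ℝ] (Fin (Module.finrank ℝ (H ⧸ V)) → ℝ) :=
    (Module.finBasis ℝ (H ⧸ V)).equivFun.toLinearMap ∘ₗ V.mkQ
  have hℓs : Function.Surjective ℓ :=
    (Module.finBasis ℝ (H ⧸ V)).equivFun.surjective.comp V.mkQ_surjective
  have hℓ0 : ∀ v, ℓ v = 0 ↔ v ∈ V := fun v => by simp [ℓ]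
  let ℓc : H →L[ℝ] (Fin (Module.finrank ℝ (H ⧸ V)) → ℝ) := LinearMap.toContinuousLinearMap ℓ
  have hφU : ∀ z ∈ U, ContDiffAt ℝ (⊤ : ℕ∞) φ z := fun z hz =>
    hφ.contDiffAt (mem_of_superset (hU.mem_nhds hz) hUs)
  have hdφ : Function.Surjective (fderiv ℝ φ p) := by
    have hps : p ∈ φ.source := hUs hpU
    have h1 : HasFDerivWithinAt φ.symm (fderivWithin ℝ φ.symm φ.target (φ p)) φ.target (φ p) :=
      ((hψ (φ p) (φ.map_source hps)).differentiableWithinAt (by simp)).hasFDerivWithinAt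
    have h2 : HasFDerivWithinAt φ (fderiv ℝ φ p) U p :=
      ((hφU p hpU).differentiableAt (by simp)).hasFDerivAt.hasFDerivWithinAt
    have h3 := (h1.comp p h2 fun z hz => φ.map_source (hUs hz)).hasFDerivAt (hU.mem_nhds hpU)
    have h4 : HasFDerivAt (φ.symm ∘ φ) (ContinuousLinearMap.id ℝ H) p := by
      refine (hasFDerivAt_id p).congr_of_eventuallyEq ?_
      filter_upwards [hU.mem_nhds hpU] with z hz
      exact φ.left_inv (hUs hz)
    have h5 := h3.unique h4
    refine (LinearMap.injective_iff_surjective (f := (fderiv ℝ φ p).toLinearMap)).1 ?_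
    refine Function.LeftInverse.injective
      (g := fderivWithin ℝ φ.symm φ.target (φ p)) fun v => ?_
    exact DFunLike.congr_fun h5 v
  obtain ⟨h, hh, hheq⟩ := exists_contDiff_eventuallyEq_s6 (f := fun z => ℓc (φ z)) (p := p) (by
    filter_upwards [hU.mem_nhds hpU] with z hz
    exact ℓc.contDiff.contDiffAt.comp z (hφU z hz))
  refine ⟨_, h, hh, ?_, ?_⟩
  · have h1 : HasFDerivAt (fun z => ℓc (φ z)) (ℓc.comp (fderiv ℝ φ p)) p :=
      ℓc.hasFDerivAt.comp p ((hφU p hpU).differentiableAt (by simp)).hasFDerivAt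
    rw [hheq.fderiv_eq, h1.fderiv]
    exact hℓs.comp hdφ
  · filter_upwards [hheq, hU.mem_nhds hpU] with z hz hzU
    rw [hz]
    refine Iff.trans ?_ (hℓ0 (φ z)).symm
    constructor
    · intro hzS
      exact (hSV.subset ⟨z, ⟨hzS, hzU⟩, rfl⟩).2
    · intro hzV
      obtain ⟨w, ⟨hwS, hwU⟩, hw⟩ := hSV.superset ⟨⟨z, hzU, rfl⟩, hzV⟩
      have : w = z := φ.injOn (hUs hwU) (hUs hzU) hw
      exact this ▸ hwS

/-- The regular zero set of a smooth submersion is a submanifold near a given point. -/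
theorem exists_isSubmanifold_of_surjective {H F : Type*} [NormedAddCommGroup H]
    [NormedSpace ℝ H] [FiniteDimensional ℝ H] [NormedAddCommGroup F] [NormedSpace ℝ F]
    [FiniteDimensional ℝ F] {G : H → F} (hG : ContDiff ℝ (⊤ : ℕ∞) G) {p : H}
    (hp : Function.Surjective (fderiv ℝ G p)) {n : ℕ}
    (hn : Module.finrank ℝ H = Module.finrank ℝ F + n) :
    ∃ W ∈ 𝓝 p, ∀ O ⊆ W, IsOpen O → IsSubmanifold n {z | z ∈ O ∧ G z = 0} := by
  let T := LinearMap.ker (fderiv ℝ G p).toLinearMap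
  have hT : Module.finrank ℝ T = n := by
    have h1 := LinearMap.finrank_range_add_finrank_ker (fderiv ℝ G p).toLinearMap
    rw [LinearMap.range_eq_top.2 hp, finrank_top] at h1
    simp only [T]
    omega
  obtain ⟨π, hπ⟩ := T.subtype.exists_leftInverse_of_injective T.ker_subtype
  have hπ' : ∀ t : T, π t = t := fun t => DFunLike.congr_fun hπ t
  let πc : H →L[ℝ] T := LinearMap.toContinuousLinearMap π
  let L : (F × T) ≃ₗ[ℝ] H := LinearEquiv.ofFinrankEq _ _ (by rw [Module.finrank_prod, hT, hn])
  let Lc := L.toContinuousLinearEquiv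
  let f : H → H := fun z => Lc (G z, πc z)
  have hf : ContDiff ℝ (⊤ : ℕ∞) f := Lc.contDiff.comp (hG.prodMk πc.contDiff)
  have hdf : HasFDerivAt f ((Lc : (F × T) →L[ℝ] H).comp ((fderiv ℝ G p).prod πc)) p :=
    Lc.hasFDerivAt.comp p (((hG.differentiable (by simp)).differentiableAt.hasFDerivAt).prodMk
      πc.hasFDerivAt)
  have hinj : Function.Injective (fderiv ℝ f p) := by
    rw [hdf.fderiv]
    refine Lc.injective.comp ?_
    refine (injective_iff_map_eq_zero ((fderiv ℝ G p).prod πc)).2 fun v hv => ?_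
    have h1 : fderiv ℝ G p v = 0 := congrArg Prod.fst hv
    have h2 : π v = 0 := congrArg Prod.snd hv
    have h3 := hπ' ⟨v, h1⟩
    rw [h2] at h3
    exact (congrArg Subtype.val h3).symm
  obtain ⟨Φ, hpΦ, hΦ, hΦs⟩ := exists_openPartialHomeomorph_of_bijective hf
    ⟨hinj, (LinearMap.injective_iff_surjective (f := (fderiv ℝ f p).toLinearMap)).1 hinj⟩
  refine ⟨Φ.source, Φ.open_source.mem_nhds hpΦ, fun O hO hOo z hz => ?_⟩
  let V : Submodule ℝ H := (LinearMap.ker (LinearMap.fst ℝ F T)).map L.toLinearMap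
  have hV : ∀ w, f w ∈ V ↔ G w = 0 := fun w => by
    constructor
    · rintro ⟨q, hq, hqw⟩
      have : q = (G w, πc w) := L.injective hqw
      subst this
      exact hq
    · intro hw
      exact ⟨(G w, πc w), hw, rfl⟩
  refine ⟨O, Φ.toPartialHomeomorph, V, hz.1, hOo, hO, ?_, hΦs, ?_, ?_⟩
  · exact hf.contDiffOn.congr fun w _ => hΦ w
  · rw [LinearEquiv.finrank_map_eq, ← hT]
    have h1 := LinearMap.finrank_range_add_finrank_ker (LinearMap.fst ℝ F T)
    rw [LinearMap.range_eq_top.2 LinearMap.fst_surjective, finrank_top, Module.finrank_prod] at h1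
    omega
  · ext y
    constructor
    · rintro ⟨w, ⟨⟨-, hw⟩, hwO⟩, rfl⟩
      exact ⟨⟨w, hwO, rfl⟩, (congrArg (· ∈ V) (hΦ w)).mpr ((hV w).2 hw)⟩
    · rintro ⟨⟨w, hwO, rfl⟩, hwV⟩
      exact ⟨w, ⟨⟨hwO, (hV w).1 ((congrArg (· ∈ V) (hΦ w)).mp hwV)⟩, hwO⟩, rfl⟩

theorem eq_of_mem_Tang {E F : Type*} [NormedAddCommGroup E] [NormedSpace ℝ E]
    [NormedAddCommGroup F] [NormedSpace ℝ F] {S : Set E} {x : E} {f g : E → F}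
    {f' g' : E →L[ℝ] F} (hf : HasFDerivAt f f' x) (hg : HasFDerivAt g g' x) (hx : f x = g x)
    (hfg : ∀ᶠ z in 𝓝 x, z ∈ S → f z = g z) {v : E} (hv : v ∈ Tang S x) : f' v = g' v := by
  suffices Tang S x ≤ LinearMap.ker (f' - g').toLinearMap by
    have := this hv
    exact sub_eq_zero.1 this
  refine Submodule.span_le.2 fun y hy => ?_
  obtain ⟨ι, l, hl, c, d, hd₀, hds, hcd⟩ := exists_fun_of_mem_tangentConeAt hy
  have h1 := ((hf.sub hg).hasFDerivWithinAt (s := S)).lim hd₀ hds hcd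
  refine tendsto_nhds_unique h1 (tendsto_const_nhds.congr' ?_)
  have h2 : Tendsto (fun n => x + d n) l (𝓝 x) := by
    simpa using tendsto_const_nhds.add hd₀
  filter_upwards [hds, h2.eventually hfg] with n hn hn'
  simp [hn' hn, hx]

theorem mem_Tang_of_surjective {E F : Type*} [NormedAddCommGroup E] [NormedSpace ℝ E]
    [CompleteSpace E] [NormedAddCommGroup F] [NormedSpace ℝ F] [FiniteDimensional ℝ F]
    {S : Set E} {x : E} {h : E → F}
    {h' : E →L[ℝ] F} (hh : HasStrictFDerivAt h h' x) (hs : Function.Surjective h') (hx : h x = 0)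
    (hS : ∀ᶠ z in 𝓝 x, h z = 0 → z ∈ S) {v : E} (hv : h' v = 0) : v ∈ Tang S x := by
  have hr : h'.range = ⊤ := LinearMap.range_eq_top.2 hs
  let w : h'.ker := ⟨v, hv⟩
  let γ : ℝ → E := fun t => hh.implicitFunction h h' hr (h x) (t • w)
  have hl : HasFDerivAt (fun t : ℝ => t • w) (ContinuousLinearMap.toSpanSingleton ℝ w) 0 :=
    (ContinuousLinearMap.toSpanSingleton ℝ w).hasFDerivAt
  have hγ : HasFDerivAt γ (h'.ker.subtypeL.comp (ContinuousLinearMap.toSpanSingleton ℝ w)) 0 := by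
    refine HasFDerivAt.comp (0 : ℝ) ?_ hl
    rw [zero_smul]
    exact (hh.to_implicitFunction hr).hasFDerivAt
  have hγ0 : γ 0 = x := by simp [γ]
  have h1 : ∀ᶠ t in 𝓝 (0 : ℝ), h (γ t) = h x := by
    have ht : Tendsto (fun t : ℝ => (h x, t • w)) (𝓝 0) (𝓝 (h x, 0)) := by
      have : Continuous fun t : ℝ => (h x, t • w) := by fun_prop
      simpa using this.tendsto 0
    exact ht.eventually (hh.map_implicitFunction_eq hr)
  have h2 : ∀ᶠ t in 𝓝 (0 : ℝ), γ t ∈ S := by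
    have ht : Tendsto γ (𝓝 0) (𝓝 x) := by
      simpa [hγ0] using hγ.continuousAt.tendsto
    filter_upwards [h1, ht.eventually hS] with t ht1 ht2
    exact ht2 (ht1.trans hx)
  have h2' : γ ⁻¹' S ∈ 𝓝 (0 : ℝ) := h2
  have h3 := (hγ.hasFDerivWithinAt (s := γ ⁻¹' S)).mapsTo_tangent_cone (show (1 : ℝ) ∈ _ by
    rw [tangentConeAt_congr (t := univ) (by rw [nhdsWithin_univ, nhdsWithin_eq_nhds.2 h2']),
      tangentConeAt_univ]
    trivial)
  rw [hγ0] at h3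
  refine Submodule.subset_span (tangentConeAt_mono (image_preimage_subset γ S) ?_)
  simpa [w] using h3

/-- Two zero sets, one contained in the other, whose linearisations at a common point have the
same kernel agree near that point. -/
theorem eventually_eq_zero_of_ker_le {H F F' : Type*} [NormedAddCommGroup H]
    [NormedSpace ℝ H] [FiniteDimensional ℝ H] [NormedAddCommGroup F] [NormedSpace ℝ F]
    [FiniteDimensional ℝ F] [NormedAddCommGroup F'] [NormedSpace ℝ F']
    [FiniteDimensional ℝ F'] {h : H → F} {B : H → F'} {h' : H →L[ℝ] F} {B' : H →L[ℝ] F'} {p : H}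
    (hh : HasStrictFDerivAt h h' p) (hB : HasStrictFDerivAt B B' p)
    (hs : Function.Surjective h') (hp : h p = 0) (hker : ∀ v, B' v = 0 → h' v = 0)
    (hhB : ∀ᶠ z in 𝓝 p, h z = 0 → B z = 0) : ∀ᶠ z in 𝓝 p, B z = 0 → h z = 0 := by
  have := FiniteDimensional.complete ℝ H
  have := FiniteDimensional.complete ℝ F
  let T := LinearMap.ker h'.toLinearMap
  obtain ⟨π, hπ⟩ := T.subtype.exists_leftInverse_of_injective T.ker_subtype
  have hπ' : ∀ t : T, π t = t := fun t => DFunLike.congr_fun hπ t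
  let πc : H →L[ℝ] T := LinearMap.toContinuousLinearMap π
  have hAh : HasStrictFDerivAt (fun z => (h z, πc z)) (h'.prod πc) p :=
    hh.prodMk πc.hasStrictFDerivAt
  have hAB : HasStrictFDerivAt (fun z => (B z, πc z)) (B'.prod πc) p :=
    hB.prodMk πc.hasStrictFDerivAt
  have hsurj : (h'.prod πc).range = ⊤ := by
    refine LinearMap.range_eq_top.2 fun q => ?_
    obtain ⟨u, hu⟩ := hs q.1
    have ht : h' (q.2 - π u : T) = 0 := (q.2 - π u : T).2
    refine ⟨u + (q.2 - π u : T), Prod.ext ?_ ?_⟩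
    · change h' (u + (q.2 - π u : T)) = q.1
      rw [map_add, hu, ht, add_zero]
    · change π (u + (q.2 - π u : T)) = q.2
      rw [map_add, hπ']
      abel
  have hinj : Function.Injective (B'.prod πc) := by
    refine (injective_iff_map_eq_zero _).2 fun v hv => ?_
    have h1 : h' v = 0 := hker v (congrArg Prod.fst hv)
    have h2 : π v = 0 := congrArg Prod.snd hv
    have h3 := hπ' ⟨v, h1⟩
    rw [h2] at h3
    exact (congrArg Subtype.val h3).symm
  obtain ⟨g, hg⟩ := (B'.prod πc).toLinearMap.exists_leftInverse_of_injective
    (LinearMap.ker_eq_bot.2 hinj)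
  let gc : F' × T →L[ℝ] H := LinearMap.toContinuousLinearMap g
  have hgA : HasStrictFDerivAt (fun z => gc (B z, πc z))
      ((ContinuousLinearEquiv.refl ℝ H : H ≃L[ℝ] H) : H →L[ℝ] H) p := by
    refine (gc.hasStrictFDerivAt.comp p hAB).congr_fderiv ?_
    ext v
    exact DFunLike.congr_fun hg v
  obtain ⟨W, hW, hWinj⟩ : ∃ W ∈ 𝓝 p, InjOn (fun z => (B z, πc z)) W := by
    refine ⟨(hgA.toOpenPartialHomeomorph _).source,
      (hgA.toOpenPartialHomeomorph _).open_source.mem_nhds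
        hgA.mem_toOpenPartialHomeomorph_source, fun y hy z hz hyz => ?_⟩
    exact (hgA.toOpenPartialHomeomorph _).injOn hy hz (congrArg gc hyz)
  have hopen := hAh.map_nhds_eq_of_surj hsurj
  have h4 : (fun z => (h z, πc z)) '' (W ∩ {z | h z = 0 → B z = 0}) ∈ 𝓝 (h p, πc p) := by
    rw [← hopen]
    exact image_mem_map (inter_mem hW hhB)
  rw [hp] at h4
  have h5 : Tendsto (fun z => ((0 : F), πc z)) (𝓝 p) (𝓝 (0, πc p)) :=
    (by fun_prop : Continuous fun z => ((0 : F), πc z)).tendsto p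
  filter_upwards [h5 h4, hW] with z hz hzW hBz
  obtain ⟨s, ⟨hsW, hs0⟩, hsz⟩ := hz
  have h6 : h s = 0 := congrArg Prod.fst hsz
  have h7 : πc s = πc z := congrArg Prod.snd hsz
  have : s = z := hWinj hsW hzW (Prod.ext ((hs0 h6).trans hBz.symm) h7)
  exact this ▸ h6

/-- A smooth retraction onto a zero set which preserves the last coordinate. -/
theorem exists_retraction {E F : Type*} [NormedAddCommGroup E]
    [NormedSpace ℝ E] [FiniteDimensional ℝ E] [NormedAddCommGroup F] [NormedSpace ℝ F]
    [FiniteDimensional ℝ F] {h : E × ℝ → F} (hh : ContDiff ℝ (⊤ : ℕ∞) h) {p : E × ℝ} (hp : h p = 0)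
    (hs : Function.Surjective fun v : E => fderiv ℝ h p (v, 0)) :
    ∃ σ : E × ℝ → E × ℝ, (∀ᶠ z in 𝓝 p, ContDiffAt ℝ (⊤ : ℕ∞) σ z) ∧ σ p = p ∧
      ∀ᶠ z in 𝓝 p, h (σ z) = 0 ∧ (σ z).2 = z.2 ∧ (h z = 0 → σ z = z) := by
  let h' : E →ₗ[ℝ] F := (fderiv ℝ h p).toLinearMap ∘ₗ LinearMap.inl ℝ E ℝ
  let T := LinearMap.ker h'
  obtain ⟨π, hπ⟩ := T.subtype.exists_leftInverse_of_injective T.ker_subtype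
  have hπ' : ∀ t : T, π t = t := fun t => DFunLike.congr_fun hπ t
  let πc : E →L[ℝ] T := LinearMap.toContinuousLinearMap π
  let f : E × ℝ → F × T × ℝ := fun z => (h z, πc z.1, z.2)
  have hf : ContDiff ℝ (⊤ : ℕ∞) f :=
    hh.prodMk ((πc.contDiff.comp contDiff_fst).prodMk contDiff_snd)
  have hdf : HasFDerivAt f ((fderiv ℝ h p).prod
      ((πc.comp (ContinuousLinearMap.fst ℝ E ℝ)).prod (ContinuousLinearMap.snd ℝ E ℝ))) p :=
    ((hh.differentiable (by simp)).differentiableAt.hasFDerivAt).prodMk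
      ((πc.comp (ContinuousLinearMap.fst ℝ E ℝ)).prod (ContinuousLinearMap.snd ℝ E ℝ)).hasFDerivAt
  have hbij : Function.Bijective (fderiv ℝ f p) := by
    rw [hdf.fderiv]
    constructor
    · refine (injective_iff_map_eq_zero ((fderiv ℝ h p).prod
        ((πc.comp (ContinuousLinearMap.fst ℝ E ℝ)).prod (ContinuousLinearMap.snd ℝ E ℝ)))).2 ?_
      rintro ⟨v, s⟩ hv
      have h1 : fderiv ℝ h p (v, s) = 0 := congrArg Prod.fst hv
      have h2 : π v = 0 := congrArg (fun q => q.2.1) hv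
      have h4 : s = 0 := congrArg (fun q => q.2.2) hv
      subst h4
      have h3 := hπ' ⟨v, h1⟩
      rw [h2] at h3
      exact Prod.ext (congrArg Subtype.val h3).symm rfl
    · rintro ⟨a, t, s⟩
      obtain ⟨u, hu⟩ := hs (a - fderiv ℝ h p (0, s))
      have ht : fderiv ℝ h p (((t - π u : T) : E), 0) = 0 := (t - π u : T).2
      refine ⟨(u + (t - π u : T), s), Prod.ext ?_ (Prod.ext ?_ rfl)⟩
      · change fderiv ℝ h p (u + (t - π u : T), s) = a
        have : ((u + (t - π u : T), s) : E × ℝ) =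
            (u, 0) + (((t - π u : T) : E), 0) + (0, s) := by simp
        rw [this, map_add, map_add, ht]
        simp only at hu
        rw [hu]
        simp
      · change π (u + (t - π u : T)) = t
        rw [map_add, hπ']
        abel
  obtain ⟨Φ, hpΦ, hΦ, hΦs⟩ := exists_openPartialHomeomorph_of_bijective hf hbij
  let ρ : E × ℝ → F × T × ℝ := fun z => (0, πc z.1, z.2)
  have hρ : ContDiff ℝ (⊤ : ℕ∞) ρ :=
    contDiff_const.prodMk ((πc.contDiff.comp contDiff_fst).prodMk contDiff_snd)
  have hρz : ∀ z, h z = 0 → ρ z = f z := fun z hz => by simp [ρ, f, hz]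
  have hpt : ρ p ∈ Φ.target := by
    rw [hρz p hp, ← hΦ]
    exact Φ.map_source hpΦ
  have hev : ∀ᶠ z in 𝓝 p, ρ z ∈ Φ.target :=
    hρ.continuous.tendsto p (Φ.open_target.mem_nhds hpt)
  have hret : ∀ z ∈ Φ.source, h z = 0 → Φ.symm (ρ z) = z := fun z hz hz0 => by
    rw [hρz z hz0, ← hΦ, Φ.left_inv hz]
  refine ⟨fun z => Φ.symm (ρ z), ?_, hret p hpΦ hp, ?_⟩
  · filter_upwards [hev] with z hz
    exact (hΦs.contDiffAt (Φ.open_target.mem_nhds hz)).comp z hρ.contDiffAt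
  · filter_upwards [hev, Φ.open_source.mem_nhds hpΦ] with z hz hzs
    have h1 : f (Φ.symm (ρ z)) = ρ z := by rw [← hΦ, Φ.right_inv hz]
    exact ⟨congrArg Prod.fst h1, congrArg (fun q => q.2.2) h1, hret z hzs⟩

theorem GeneratesWith.eventually_fderiv_velocity {E F : Type*} [NormedAddCommGroup E]
    [NormedSpace ℝ E] [NormedAddCommGroup F] [NormedSpace ℝ F] {N : ℝ → Set E} {X φ : ℝ → E → E}
    (hX : GeneratesWith N X φ) {h : E × ℝ → F} (hh : ContDiff ℝ (⊤ : ℕ∞) h) {m : E}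
    (hS : ∀ᶠ z : E × ℝ in 𝓝 (m, 0), z.1 ∈ N z.2 → h z = 0) :
    ∀ᶠ x in 𝓝 m, x ∈ N 0 → fderiv ℝ h (x, 0) (X 0 x, 1) = 0 := by
  obtain ⟨-, ⟨hφ0, hφ⟩, hφN, -⟩ := hX
  have hx0 : Tendsto (fun x : E => (x, (0 : ℝ))) (𝓝 m) (𝓝 (m, 0)) :=
    (by fun_prop : Continuous fun x : E => (x, (0 : ℝ))).tendsto m
  filter_upwards [hx0.eventually hS.eventually_nhds] with x hx hxN
  have h1 : HasDerivAt (fun t => (φ t x, t)) (X 0 x, 1) 0 := by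
    have := (hφ 0 x).prodMk (hasDerivAt_id (0 : ℝ))
    rwa [hφ0] at this
  have h2 : HasFDerivAt h (fderiv ℝ h (x, 0)) (φ 0 x, 0) := by
    rw [hφ0]
    exact (hh.differentiable (by simp)).differentiableAt.hasFDerivAt
  have h3 : HasDerivAt (h ∘ fun t => (φ t x, t)) (fderiv ℝ h (x, 0) (X 0 x, 1)) 0 :=
    HasFDerivAt.comp_hasDerivAt (f := fun t => (φ t x, t)) (0 : ℝ) h2 h1
  have h4 : Tendsto (fun t => (φ t x, t)) (𝓝 0) (𝓝 (x, 0)) := by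
    simpa [hφ0] using h1.continuousAt.tendsto
  refine h3.unique ((hasDerivAt_const (0 : ℝ) (0 : F)).congr_of_eventuallyEq ?_)
  filter_upwards [h4.eventually hx, hφN] with t ht htN
  exact ht (htN ▸ mem_image_of_mem _ hxN)

theorem surjective_slice {E F : Type*} [NormedAddCommGroup E] [NormedSpace ℝ E]
    [NormedAddCommGroup F] [NormedSpace ℝ F] {L : E × ℝ →L[ℝ] F} (hL : Function.Surjective L)
    {X : E} (hX : L (X, 1) = 0) : Function.Surjective fun v : E => L (v, 0) := by
  intro y
  obtain ⟨⟨w, s⟩, hw⟩ := hL y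
  refine ⟨w - s • X, ?_⟩
  have : ((w - s • X, 0) : E × ℝ) = (w, s) - s • (X, 1) := by simp
  simp only [this, map_sub, map_smul, hX, hw, smul_zero, sub_zero]

theorem fderiv_slice_eq_zero_of_mem_Tang {E F : Type*} [NormedAddCommGroup E] [NormedSpace ℝ E]
    [NormedAddCommGroup F] [NormedSpace ℝ F] {N : ℝ → Set E} {h : E × ℝ → F}
    (hh : ContDiff ℝ (⊤ : ℕ∞) h) {m : E} (hm : h (m, 0) = 0)
    (hS : ∀ᶠ z : E × ℝ in 𝓝 (m, 0), z.1 ∈ N z.2 → h z = 0) {v : E} (hv : v ∈ Tang (N 0) m) :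
    fderiv ℝ h (m, 0) (v, 0) = 0 := by
  have h1 : HasFDerivAt (fun x => h (x, 0)) ((fderiv ℝ h (m, 0)).comp
      (ContinuousLinearMap.inl ℝ E ℝ)) m :=
    (hh.differentiable (by simp)).differentiableAt.hasFDerivAt.comp m
      (hasFDerivAt_prodMk_left m 0)
  have hx0 : Tendsto (fun x : E => (x, (0 : ℝ))) (𝓝 m) (𝓝 (m, 0)) :=
    (by fun_prop : Continuous fun x : E => (x, (0 : ℝ))).tendsto m
  exact eq_of_mem_Tang h1 (hasFDerivAt_const (0 : F) m) hm (hx0.eventually hS) hv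

theorem mem_Tang_slice_of_fderiv_eq_zero {E F : Type*} [NormedAddCommGroup E] [NormedSpace ℝ E]
    [CompleteSpace E] [NormedAddCommGroup F] [NormedSpace ℝ F] [FiniteDimensional ℝ F]
    {N : ℝ → Set E} {h : E × ℝ → F} (hh : ContDiff ℝ (⊤ : ℕ∞) h) {m : E}
    (hs : Function.Surjective fun v : E => fderiv ℝ h (m, 0) (v, 0)) (hm : h (m, 0) = 0)
    (hS : ∀ᶠ z : E × ℝ in 𝓝 (m, 0), h z = 0 → z.1 ∈ N z.2) {v : E}
    (hv : fderiv ℝ h (m, 0) (v, 0) = 0) : v ∈ Tang (N 0) m := by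
  have h1 : HasStrictFDerivAt (fun x => h (x, 0)) ((fderiv ℝ h (m, 0)).comp
      (ContinuousLinearMap.inl ℝ E ℝ)) m :=
    HasStrictFDerivAt.comp m (hh.contDiffAt.hasStrictFDerivAt (by simp))
      ((hasStrictFDerivAt_id m).prodMk (hasStrictFDerivAt_const (0 : ℝ) m))
  have hx0 : Tendsto (fun x : E => (x, (0 : ℝ))) (𝓝 m) (𝓝 (m, 0)) :=
    (by fun_prop : Continuous fun x : E => (x, (0 : ℝ))).tendsto m
  exact mem_Tang_of_surjective h1 hs hm (hx0.eventually hS) hv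

/-- Theorem 1.14 of the paper.  If `m ∈ N₀` is an infinitesimal
intersection, transverse in the constraint `P_ε`, of two smooth families of compact
submanifolds `N_ε^± ⊆ P_ε` deforming the same `N₀`, then near `m` there is a smooth family
of submanifolds `Λ_ε` with `Λ₀ ⊆ N₀` and `Λ_ε = N_ε⁺ ∩ N_ε⁻` (near `m`) for all small
enough `ε ≠ 0`. -/
theorem constrained_transverse_infinitesimal_intersection_persists
    {E : Type*} [NormedAddCommGroup E] [NormedSpace ℝ E] [FiniteDimensional ℝ E]
    (d e : ℕ) (Np Nm P : ℝ → Set E)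
    (hNp : IsSmoothFamily d Np) (hNm : IsSmoothFamily d Nm) (h0 : Np 0 = Nm 0)
    (hP : IsSmoothFamily e P) (hsub : ∀ ε, Np ε ∪ Nm ε ⊆ P ε)
    (Xp Xm : ℝ → E → E) (hpair : GeneratesPair Np Nm Xp Xm)
    (m : E) (hm : m ∈ Np 0) (hint : Xp 0 m = Xm 0 m)
    (htrans : (Tang (Np 0) m).map (Dop Xp Xm m) ⊓ Tang (Np 0) m = ⊥ ∧
      (Tang (Np 0) m).map (Dop Xp Xm m) ⊔ Tang (Np 0) m = Tang (P 0) m) :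
    ∃ U ∈ 𝓝 m, ∃ (k : ℕ) (Λ : ℝ → Set E),
      IsSmoothFamilySub k Λ ∧ m ∈ Λ 0 ∧ Λ 0 ⊆ Np 0 ∧
      ∀ᶠ ε in 𝓝[≠] (0 : ℝ), Λ ε = Np ε ∩ Nm ε ∩ U := by
  obtain ⟨⟨φp, hXp⟩, ⟨φm, hXm⟩, -⟩ := hpair
  have hmm : m ∈ Nm 0 := h0 ▸ hm
  obtain ⟨c, hp, hpC, hpS, hpZ⟩ := hNp.2.exists_defining (p := (m, 0)) hm
  obtain ⟨c', hq, hqC, hqS, hqZ⟩ := hNm.2.exists_defining (p := (m, 0)) hmm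
  obtain ⟨c'', q, qC, qS, qZ⟩ :=
    hP.2.exists_defining (p := (m, 0)) (hsub 0 (Or.inl hm))
  have hNpP : ∀ z : E × ℝ, z.1 ∈ Np z.2 → z.1 ∈ P z.2 := fun z hz => hsub _ (Or.inl hz)
  have hNmP : ∀ z : E × ℝ, z.1 ∈ Nm z.2 → z.1 ∈ P z.2 := fun z hz => hsub _ (Or.inr hz)
  have hpX := (hXp.eventually_fderiv_velocity hpC (hpZ.mono fun z => Iff.mp)).self_of_nhds hm
  have hqX := (hXm.eventually_fderiv_velocity hqC (hqZ.mono fun z => Iff.mp)).self_of_nhds hmm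
  have qX := (hXp.eventually_fderiv_velocity qC
    (qZ.mono fun z hz h => hz.1 (hNpP z h))).self_of_nhds hm
  have hps := surjective_slice hpS hpX
  have hp0 : hp (m, 0) = 0 := hpZ.self_of_nhds.1 hm
  have hq0 : hq (m, 0) = 0 := hqZ.self_of_nhds.1 hmm
  have q0 : q (m, 0) = 0 := qZ.self_of_nhds.1 (hsub 0 (Or.inl hm))
  have hpK : ∀ v ∈ Tang (Np 0) m, fderiv ℝ hp (m, 0) (v, 0) = 0 := fun v =>
    fderiv_slice_eq_zero_of_mem_Tang hpC hp0 (hpZ.mono fun z => Iff.mp)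
  have hqK : ∀ v ∈ Tang (Np 0) m, fderiv ℝ hq (m, 0) (v, 0) = 0 := fun v hv =>
    fderiv_slice_eq_zero_of_mem_Tang hqC hq0 (hqZ.mono fun z => Iff.mp) (h0 ▸ hv)
  have hKp : ∀ v, fderiv ℝ hp (m, 0) (v, 0) = 0 → v ∈ Tang (Np 0) m := fun v =>
    mem_Tang_slice_of_fderiv_eq_zero hpC hps hp0 (hpZ.mono fun z => Iff.mpr)
  have hKP : ∀ v, fderiv ℝ q (m, 0) (v, 0) = 0 → v ∈ Tang (P 0) m := fun v =>
    mem_Tang_slice_of_fderiv_eq_zero qC (surjective_slice qS qX) q0 (qZ.mono fun z => Iff.mpr)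
  -- reduce the second defining function to the directions it sees inside the constraint
  let R : Submodule ℝ (Fin c' → ℝ) := ((Tang (Np 0) m).map (Dop Xp Xm m)).map
    ((fderiv ℝ hq (m, 0)).toLinearMap ∘ₗ LinearMap.inl ℝ E ℝ)
  obtain ⟨ρ, hρ⟩ := R.subtype.exists_leftInverse_of_injective R.ker_subtype
  have hρ' : ∀ t : R, ρ t = t := fun t => DFunLike.congr_fun hρ t
  let ρc : (Fin c' → ℝ) →L[ℝ] R := LinearMap.toContinuousLinearMap ρ
  let h : E × ℝ → R := fun z => ρc (hq z)
  have hC : ContDiff ℝ (⊤ : ℕ∞) h := ρc.contDiff.comp hqC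
  have hh' : ∀ z, fderiv ℝ h z = ρc.comp (fderiv ℝ hq z) := fun z =>
    (ρc.hasFDerivAt.comp z (hqC.differentiable (by simp)).differentiableAt.hasFDerivAt).fderiv
  have hR : ∀ v ∈ Tang (Np 0) m, fderiv ℝ hq (m, 0) (Dop Xp Xm m v, 0) ∈ R := fun v hv =>
    Submodule.mem_map_of_mem (Submodule.mem_map_of_mem hv)
  have hcut : ∀ᶠ z : E × ℝ in 𝓝 (m, 0), q z = 0 ∧ h z = 0 → hq z = 0 := by
    have hst : ∀ {F : Type _} [NormedAddCommGroup F] [NormedSpace ℝ F] {f : E × ℝ → F},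
        ContDiff ℝ (⊤ : ℕ∞) f → HasStrictFDerivAt f (fderiv ℝ f (m, 0)) (m, 0) := fun hf =>
      hf.contDiffAt.hasStrictFDerivAt (by simp)
    have hker : ∀ v : E × ℝ, ((fderiv ℝ q (m, 0)).prod (fderiv ℝ h (m, 0))) v = 0 →
        fderiv ℝ hq (m, 0) v = 0 := by
      rintro ⟨w, s⟩ hv
      have h1 : fderiv ℝ q (m, 0) (w, s) = 0 := congrArg Prod.fst hv
      have h2 : ρ (fderiv ℝ hq (m, 0) (w, s)) = 0 := by
        have : fderiv ℝ h (m, 0) (w, s) = 0 := congrArg Prod.snd hv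
        rwa [hh'] at this
      have hdec : ((w, s) : E × ℝ) = (w - s • Xp 0 m, 0) + s • (Xp 0 m, 1) := by simp
      have h3 : fderiv ℝ q (m, 0) (w - s • Xp 0 m, 0) = 0 := by
        rwa [hdec, map_add, map_smul, qX, smul_zero, add_zero] at h1
      have h4 := hKP _ h3
      rw [← htrans.2] at h4
      obtain ⟨_, ⟨a, ha, rfl⟩, b, hb, hab⟩ := Submodule.mem_sup.1 h4
      have h5 : fderiv ℝ hq (m, 0) (w, s) = fderiv ℝ hq (m, 0) (Dop Xp Xm m a, 0) := by
        have : ((w, s) : E × ℝ) = (Dop Xp Xm m a, 0) + (b, 0) + s • (Xp 0 m, 1) := by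
          rw [hdec, ← hab]; simp
        rw [this, map_add, map_add, map_smul, hint, hqX, hqK b hb]
        simp
      have h6 := hρ' ⟨_, hR a ha⟩
      rw [h5] at h2 ⊢
      rw [h2] at h6
      exact (congrArg Subtype.val h6).symm
    refine (eventually_eq_zero_of_ker_le (B := fun z => (q z, h z)) (hst hqC)
      ((hst qC).prodMk (hst hC)) hqS hq0 hker ?_).mono fun z hz hz' => hz (Prod.ext hz'.1 hz'.2)
    filter_upwards [hqZ, qZ] with z hz1 hz2 hz
    exact Prod.ext (hz2.1 (hNmP z (hz1.2 hz))) (by simp [h, hz])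
  -- restrict to the first family and divide by the parameter
  obtain ⟨σ, hσC, hσp, hσ⟩ := exists_retraction hpC hp0 hps
  obtain ⟨g, hgC, hg⟩ := exists_contDiff_eventuallyEq_s6 (f := fun z => h (σ z)) (p := (m, 0))
    (hσC.mono fun z hz => hC.contDiffAt.comp z hz)
  obtain ⟨b, hbC, hgb, hb0⟩ := exists_contDiff_eq_add_smul hgC
  have hx0 : ∀ x : E, Tendsto (fun x : E => (x, (0 : ℝ))) (𝓝 x) (𝓝 (x, 0)) := fun x =>
    (by fun_prop : Continuous fun x : E => (x, (0 : ℝ))).tendsto x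
  have hg0 : ∀ᶠ x in 𝓝 m, g (x, 0) = 0 := by
    have hσt : Tendsto σ (𝓝 (m, 0)) (𝓝 (m, 0)) := by
      simpa [hσp] using hσC.self_of_nhds.continuousAt.tendsto
    filter_upwards [hx0 m hg, (hx0 m).eventually hσ, (hx0 m).eventually (hσt.eventually hpZ),
      (hx0 m).eventually (hσt.eventually hqZ)] with x h1 h2 h3 h4
    have h5 : (σ (x, 0)).1 ∈ Nm (σ (x, 0)).2 := by
      have := h3.2 h2.1
      rw [h2.2.1] at this ⊢
      exact h0 ▸ this
    have h6 : g (x, 0) = h (σ (x, 0)) := h1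
    simp [h6, h, h4.1 h5]
  have hgh : ∀ᶠ z in 𝓝 ((m, 0) : E × ℝ), hp z = 0 → g z = h z := by
    filter_upwards [hg, hσ] with z h1 h2 h3
    rw [h1, h2.2.2 h3]
  have hbN : ∀ᶠ x in 𝓝 m, x ∈ Np 0 → b (x, 0) = fderiv ℝ h (x, 0) (Xp 0 x - Xm 0 x, 0) := by
    have h1 := hXp.eventually_fderiv_velocity (hgC.sub hC) (m := m) (by
      filter_upwards [hgh, hpZ] with z h1 h2 h3
      exact sub_eq_zero.2 (h1 (h2.1 h3)))
    have h2 := hXm.eventually_fderiv_velocity hC (m := m) (by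
      filter_upwards [hqZ] with z h1 h2
      simp [h, h1.1 h2])
    filter_upwards [h1, h2, hg0.eventually_nhds] with x h1 h2 h3 hx
    have h4 : ∀ v, fderiv ℝ g (x, 0) (v, 0) = 0 := fun v => by
      have h5 : HasFDerivAt (fun x => g (x, 0)) ((fderiv ℝ g (x, 0)).comp
          (ContinuousLinearMap.inl ℝ E ℝ)) x :=
        (hgC.differentiable (by simp)).differentiableAt.hasFDerivAt.comp x
          (hasFDerivAt_prodMk_left x 0)
      have h6 := h5.unique ((hasFDerivAt_const 0 x).congr_of_eventuallyEq h3)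
      exact DFunLike.congr_fun h6 v
    have h5 := h1 hx
    rw [fderiv_fun_sub (hgC.differentiable (by simp)).differentiableAt
      (hC.differentiable (by simp)).differentiableAt] at h5
    have h6 : fderiv ℝ g (x, 0) (Xp 0 x, 1) = fderiv ℝ h (x, 0) (Xp 0 x, 1) := sub_eq_zero.1 h5
    have h7 : ((Xp 0 x, 1) : E × ℝ) = (Xp 0 x, 0) + (0, 1) := by simp
    have h8 : ((Xp 0 x - Xm 0 x, 0) : E × ℝ) = (Xp 0 x, 1) - (Xm 0 x, 1) := by simp
    rw [hb0, h8, map_sub, h2 (h0 ▸ hx), ← h6, h7, map_add, h4]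
    simp
  have hXd : ∀ {X : ℝ → E → E}, ContDiff ℝ (⊤ : ℕ∞) (fun p : ℝ × E => X p.1 p.2) →
      DifferentiableAt ℝ (X 0) m := fun hX =>
    ((hX.comp (contDiff_const.prodMk contDiff_id)).differentiable (by simp)).differentiableAt
  have hbD : ∀ v (hv : v ∈ Tang (Np 0) m), fderiv ℝ b (m, 0) (v, 0) = ⟨_, hR v hv⟩ := by
    intro v hv
    have hu : HasFDerivAt (fun x => (Xp 0 x - Xm 0 x, (0 : ℝ)))
        ((ContinuousLinearMap.inl ℝ E ℝ).comp (fderiv ℝ (fun x => Xp 0 x - Xm 0 x) m)) m :=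
      (ContinuousLinearMap.inl ℝ E ℝ).hasFDerivAt.comp m
        ((hXd hXp.1).sub (hXd hXm.1)).hasFDerivAt
    have hL : DifferentiableAt ℝ (fun x : E => fderiv ℝ h (x, 0)) m :=
      (((hC.fderiv_right (m := (⊤ : ℕ∞)) (by simp)).comp
        (contDiff_id.prodMk contDiff_const)).differentiable (by simp)).differentiableAt
    have hb1 : HasFDerivAt (fun x => b (x, 0)) ((fderiv ℝ b (m, 0)).comp
        (ContinuousLinearMap.inl ℝ E ℝ)) m :=
      (hbC.differentiable (by simp)).differentiableAt.hasFDerivAt.comp m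
        (hasFDerivAt_prodMk_left m 0)
    have h1 := eq_of_mem_Tang hb1 (hL.hasFDerivAt.clm_apply hu) (hbN.self_of_nhds hm) hbN hv
    refine h1.trans ?_
    refine Eq.trans ?_ (hρ' ⟨_, hR v hv⟩)
    have h2 : ((Xp 0 m - Xm 0 m, 0) : E × ℝ) = 0 := by rw [hint, sub_self]; rfl
    rw [add_apply, ContinuousLinearMap.flip_apply, h2, map_zero, add_zero, hh']
    rfl
  let G : E × ℝ → (Fin c → ℝ) × R := fun z => (hp z, b z)
  have hGC : ContDiff ℝ (⊤ : ℕ∞) G := hpC.prodMk hbC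
  have hGd : fderiv ℝ G (m, 0) = (fderiv ℝ hp (m, 0)).prod (fderiv ℝ b (m, 0)) :=
    ((hpC.differentiable (by simp)).differentiableAt.hasFDerivAt.prodMk
      (hbC.differentiable (by simp)).differentiableAt.hasFDerivAt).fderiv
  have hGS : Function.Surjective (fderiv ℝ G (m, 0)) := by
    rw [hGd]
    rintro ⟨y, t⟩
    obtain ⟨u, hu⟩ := hpS y
    obtain ⟨_, ⟨v, hv, rfl⟩, hvt⟩ := (t - fderiv ℝ b (m, 0) u).2
    refine ⟨u + (v, 0), Prod.ext ?_ ?_⟩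
    · change fderiv ℝ hp (m, 0) (u + (v, 0)) = y
      rw [map_add, hu, hpK v hv, add_zero]
    · change fderiv ℝ b (m, 0) (u + (v, 0)) = t
      have : fderiv ℝ b (m, 0) (v, 0) = t - fderiv ℝ b (m, 0) u :=
        (hbD v hv).trans (Subtype.ext hvt)
      rw [map_add, this]
      abel
  have hdim : c + Module.finrank ℝ R ≤ Module.finrank ℝ E := by
    have h1 := LinearMap.finrank_range_add_finrank_ker
      ((fderiv ℝ hp (m, 0)).toLinearMap ∘ₗ LinearMap.inl ℝ E ℝ)
    have h2 : LinearMap.ker ((fderiv ℝ hp (m, 0)).toLinearMap ∘ₗ LinearMap.inl ℝ E ℝ) =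
        Tang (Np 0) m := by
      ext v
      exact ⟨hKp v, hpK v⟩
    rw [h2, LinearMap.range_eq_top.2 hps, finrank_top, Module.finrank_fin_fun] at h1
    have h3 : Module.finrank ℝ R ≤ Module.finrank ℝ (Tang (Np 0) m) :=
      (Submodule.finrank_map_le _ _).trans (Submodule.finrank_map_le _ _)
    omega
  obtain ⟨W, hW, hWsub⟩ := exists_isSubmanifold_of_surjective hGC hGS
    (n := Module.finrank ℝ E - (c + Module.finrank ℝ R) + 1) (by
      rw [Module.finrank_prod, Module.finrank_prod, Module.finrank_fin_fun, Module.finrank_self]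
      omega)
  have hgood : ∀ᶠ z : E × ℝ in 𝓝 (m, 0), z ∈ W ∧ (z.1 ∈ Np z.2 ↔ hp z = 0) ∧
      (hp z = 0 → (z.1 ∈ Nm z.2 ↔ z.2 • b z = 0)) := by
    have hfst : Tendsto (fun z : E × ℝ => z.1) (𝓝 (m, 0)) (𝓝 m) := continuous_fst.tendsto _
    filter_upwards [hW, hpZ, hqZ, qZ, hcut, hgh, hfst.eventually hg0] with z hzW h1 h2 h3 h4 h5 h6
    refine ⟨hzW, h1, fun hz => ?_⟩
    have h7 : h z = z.2 • b z := by rw [← h5 hz, ← zero_add (z.2 • b z), ← h6]; exact hgb z.1 z.2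
    rw [← h7]
    constructor
    · intro hzm
      simp [h, h2.1 hzm]
    · intro hz0
      exact h2.2 (h4 ⟨h3.1 (hNpP z (h1.2 hz)), hz0⟩)
  obtain ⟨U, V, hUo, hmU, hVo, h0V, hUV⟩ := mem_nhds_prod_iff'.1 hgood
  refine ⟨U, hUo.mem_nhds hmU, Module.finrank ℝ E - (c + Module.finrank ℝ R),
    fun ε => {x | (x, ε) ∈ U ×ˢ V ∧ G (x, ε) = 0},
    hWsub (U ×ˢ V) (fun z hz => (hUV hz).1) (hUo.prod hVo), ?_, ?_, ?_⟩
  · refine ⟨⟨hmU, h0V⟩, Prod.ext hp0 ?_⟩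
    change b (m, 0) = 0
    have h2 : ((Xp 0 m - Xm 0 m, 0) : E × ℝ) = 0 := by rw [hint, sub_self]; rfl
    rw [hbN.self_of_nhds hm, h2, map_zero]
  · rintro x ⟨hx, hGx⟩
    exact (hUV hx).2.1.2 (congrArg Prod.fst hGx)
  · filter_upwards [self_mem_nhdsWithin, nhdsWithin_le_nhds (hVo.mem_nhds h0V)] with ε hε hεV
    ext x
    constructor
    · rintro ⟨hx, hGx⟩
      have h1 : hp (x, ε) = 0 := congrArg Prod.fst hGx
      have h2 : b (x, ε) = 0 := congrArg Prod.snd hGx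
      exact ⟨⟨(hUV hx).2.1.2 h1, ((hUV hx).2.2 h1).2 (by rw [h2, smul_zero])⟩, hx.1⟩
    · rintro ⟨⟨hxp, hxm⟩, hxU⟩
      have hx : (x, ε) ∈ U ×ˢ V := ⟨hxU, hεV⟩
      have h1 : hp (x, ε) = 0 := (hUV hx).2.1.1 hxp
      exact ⟨hx, Prod.ext h1 ((smul_eq_zero.1 (((hUV hx).2.2 h1).1 hxm)).resolve_left hε)⟩


end
end
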